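/- arXiv:1410.0676 — 3 statements merged into one kernel-verified Lean document; each statement's English description precedes it below -/
import Mathlib

section
/- For every −∞ ≤ a < b ≤ +∞ one has μ₁(a,b) ≥ 1; moreover μ₁(a,b) = 1 if and only if (a,b) = ℝ, i.e. a = −∞ and b = +∞. -/
open MeasureTheory Real Set Filter Topology

/-- The one-dimensional Gaussian density `γ₁(x) = exp(-x²/2)`. -/
noncomputable def gaussDensity1 (x : ℝ) : ℝ := Real.exp (-(x ^ 2) / 2)

/-- The Gaussian measure `γ₁(x) dx` on `ℝ`. -/
noncomputable def mGamma1 : Measure ℝ :=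
  volume.withDensity fun x => ENNReal.ofReal (gaussDensity1 x)

/-- `g` is the distributional derivative of `v` on the open interval `I`. -/
def IsWeakDerivOn (I : Set ℝ) (v g : ℝ → ℝ) : Prop :=
  ∀ φ : ℝ → ℝ, ContDiff ℝ (⊤ : ℕ∞) φ → HasCompactSupport φ → tsupport φ ⊆ I →
    (∫ x in I, v x * deriv φ x) = -∫ x in I, g x * φ x

/-- The real interval `(a,b)` for extended real endpoints. -/
def erealIoo (a b : EReal) : Set ℝ := {x : ℝ | a < (x : EReal) ∧ (x : EReal) < b}

/-- The first nontrivial Neumann eigenvalue of the one-dimensional Hermite operator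
on the (possibly unbounded) interval `(a,b)`. -/
noncomputable def mu1D (a b : EReal) : ℝ :=
  sInf { r : ℝ | ∃ v g, MemLp v 2 (mGamma1.restrict (erealIoo a b)) ∧
    MemLp g 2 (mGamma1.restrict (erealIoo a b)) ∧
    IsWeakDerivOn (erealIoo a b) v g ∧
    ¬ v =ᵐ[mGamma1.restrict (erealIoo a b)] (fun _ => (0 : ℝ)) ∧
    (∫ x in erealIoo a b, v x ∂mGamma1) = 0 ∧
    r = (∫ x in erealIoo a b, (g x) ^ 2 ∂mGamma1) /
        (∫ x in erealIoo a b, (v x) ^ 2 ∂mGamma1) }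


open scoped ContDiff

lemma gaussDensity1_pos (x : ℝ) : 0 < gaussDensity1 x := Real.exp_pos _

lemma gaussDensity1_le_one (x : ℝ) : gaussDensity1 x ≤ 1 :=
  Real.exp_le_one_iff.2 (by nlinarith [sq_nonneg x])

lemma continuous_gaussDensity1 : Continuous gaussDensity1 := by
  unfold gaussDensity1; fun_prop

lemma gaussDensity1_neg (x : ℝ) : gaussDensity1 (-x) = gaussDensity1 x := by
  simp [gaussDensity1]

lemma hasDerivAt_gaussDensity1 (x : ℝ) :
    HasDerivAt gaussDensity1 (-x * gaussDensity1 x) x := by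
  have h : HasDerivAt (fun y : ℝ => -(y ^ 2) / 2) (-x) x := by
    convert! ((hasDerivAt_pow 2 x).neg.div_const 2) using 1
    norm_num; ring
  convert! h.exp using 1
  simp only [gaussDensity1]; ring

lemma mGamma1_eq_smul_gaussianReal :
    mGamma1 = ENNReal.ofReal √(2 * π) • ProbabilityTheory.gaussianReal 0 1 := by
  rw [ProbabilityTheory.gaussianReal_of_var_ne_zero _ one_ne_zero, mGamma1,
    ← withDensity_smul' _ _ ENNReal.ofReal_ne_top]
  congr 1
  ext x
  rw [Pi.smul_apply, smul_eq_mul, ProbabilityTheory.gaussianPDF,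
    ← ENNReal.ofReal_mul (by positivity)]
  congr 1
  simp only [ProbabilityTheory.gaussianPDFReal, gaussDensity1, NNReal.coe_one, mul_one, sub_zero]
  rw [← mul_assoc, mul_inv_cancel₀ (by positivity), one_mul]

instance : IsFiniteMeasure mGamma1 := by
  rw [mGamma1_eq_smul_gaussianReal]
  exact Measure.smul_finite _ ENNReal.ofReal_ne_top

lemma volume_absolutelyContinuous_mGamma1 : volume ≪ mGamma1 :=
  withDensity_absolutelyContinuous' (by
    exact (continuous_gaussDensity1.measurable.ennreal_ofReal).aemeasurable)
    (ae_of_all _ fun x => (ENNReal.ofReal_pos.2 (gaussDensity1_pos x)).ne')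

lemma memLp_id_mGamma1 : MemLp (fun x : ℝ => x) 2 mGamma1 := by
  rw [mGamma1_eq_smul_gaussianReal]
  exact (ProbabilityTheory.memLp_id_gaussianReal' 2 (by simp)).smul_measure ENNReal.ofReal_ne_top

lemma integral_id_mGamma1 : ∫ x, x ∂mGamma1 = 0 := by
  rw [mGamma1_eq_smul_gaussianReal, integral_smul_measure,
    ProbabilityTheory.integral_id_gaussianReal, smul_zero]

lemma integral_sq_mGamma1 : ∫ x, x ^ 2 ∂mGamma1 = ∫ _, (1 : ℝ) ^ 2 ∂mGamma1 := by
  have h : ∫ x, x ^ 2 ∂(ProbabilityTheory.gaussianReal 0 1) = 1 := by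
    have := ProbabilityTheory.variance_fun_id_gaussianReal (μ := 0) (v := 1)
    rw [ProbabilityTheory.variance_eq_integral (by fun_prop)] at this
    simpa [ProbabilityTheory.integral_id_gaussianReal] using this
  rw [mGamma1_eq_smul_gaussianReal, integral_smul_measure, integral_smul_measure, h]
  simp

lemma MeasureTheory.Integrable.locallyIntegrable_of_mGamma1 {f : ℝ → ℝ}
    (hf : Integrable f mGamma1) : LocallyIntegrable f volume := by
  have h1 : Integrable (fun x => gaussDensity1 x * f x) volume := by
    have := (integrable_withDensity_iff_integrable_smul'
      (continuous_gaussDensity1.measurable.ennreal_ofReal)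
      (ae_of_all _ fun x => ENNReal.ofReal_lt_top)).1 hf
    refine this.congr (ae_of_all _ fun x => ?_)
    simp [ENNReal.toReal_ofReal (gaussDensity1_pos x).le]
  have h2 : Continuous fun x => (gaussDensity1 x)⁻¹ :=
    continuous_gaussDensity1.inv₀ fun x => (gaussDensity1_pos x).ne'
  rw [← locallyIntegrableOn_univ]
  refine ((h1.locallyIntegrable.locallyIntegrableOn univ).continuousOn_mul h2.continuousOn
    isOpen_univ.isLocallyClosed).congr (ae_of_all _ fun x => ?_)
  simp [(gaussDensity1_pos x).ne']

lemma locallyIntegrable_indicator_of_memLp {I : Set ℝ} (hI : MeasurableSet I) {f : ℝ → ℝ}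
    (hf : MemLp f 2 (mGamma1.restrict I)) : LocallyIntegrable (I.indicator f) volume :=
  ((integrable_indicator_iff hI).2 (hf.integrable (by norm_num))).locallyIntegrable_of_mGamma1

lemma integral_primitive_mul_deriv {G φ : ℝ → ℝ} (hG : LocallyIntegrable G volume) (x₀ : ℝ)
    (hφ : ContDiff ℝ ∞ φ) (hc : HasCompactSupport φ) :
    ∫ x, (∫ t in x₀..x, G t) * deriv φ x = -∫ x, G x * φ x := by
  obtain ⟨R, hR⟩ := (hc.isCompact.isBounded.union (Bornology.isBounded_singleton
    (x := x₀))).subset_ball 0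
  have hx₀ : |x₀| < R := by simpa using hR (Or.inr rfl : x₀ ∈ tsupport φ ∪ {x₀})
  have hmem {x : ℝ} (hx : x ∈ tsupport φ) : -R < x ∧ x < R := by
    have := hR (Or.inl hx)
    rw [mem_ball_zero_iff, Real.norm_eq_abs, abs_lt] at this
    exact this
  have hR0 : 0 < R := (abs_nonneg _).trans_lt hx₀
  have h_int : IntervalIntegrable G volume (-R) R :=
    (hG.integrableOn_isCompact isCompact_uIcc).intervalIntegrable
  have hx₀' : x₀ ∈ uIcc (-R) R := by
    rw [uIcc_of_le (by linarith)]; exact abs_le.1 hx₀.le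
  have hu := h_int.absolutelyContinuousOnInterval_intervalIntegral hx₀'
  have hφac : AbsolutelyContinuousOnInterval φ (-R) R :=
    (hφ.of_le (by norm_cast)).contDiffOn.absolutelyContinuousOnInterval
  have key := hu.integral_mul_deriv_eq_deriv_mul hφac
  have hz : φ R = 0 := image_eq_zero_of_notMem_tsupport fun h => lt_irrefl _ (hmem h).2
  have hz' : φ (-R) = 0 := image_eq_zero_of_notMem_tsupport fun h => lt_irrefl _ (hmem h).1
  rw [hz, hz', mul_zero, mul_zero, sub_zero, zero_sub] at key
  have hG' : ∫ x in (-R)..R, deriv (fun x => ∫ t in x₀..x, G t) x * φ x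
      = ∫ x in (-R)..R, G x * φ x := by
    refine intervalIntegral.integral_congr_ae ?_
    filter_upwards [LocallyIntegrable.ae_hasDerivAt_integral hG] with x hx _
    rw [(hx x₀).deriv]
  rw [hG'] at key
  rw [intervalIntegral.integral_eq_integral_of_support_subset,
    intervalIntegral.integral_eq_integral_of_support_subset] at key
  · exact key
  · intro x hx
    have : x ∈ tsupport φ := subset_tsupport _ (right_ne_zero_of_mul hx)
    exact ⟨(hmem this).1, (hmem this).2.le⟩
  · intro x hx
    have : x ∈ tsupport φ :=
      support_deriv_subset (right_ne_zero_of_mul hx)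
    exact ⟨(hmem this).1, (hmem this).2.le⟩

/-- A smooth function with compact support in an interval and vanishing integral has a primitive
of the same kind. -/
lemma exists_primitive_hasCompactSupport {I : Set ℝ} (hI : I.OrdConnected) {x₀ : ℝ}
    (hx₀ : x₀ ∈ I) {ψ : ℝ → ℝ} (hψ : ContDiff ℝ ∞ ψ) (hc : HasCompactSupport ψ)
    (hs : tsupport ψ ⊆ I) (h0 : ∫ x, ψ x = 0) :
    ∃ φ : ℝ → ℝ, ContDiff ℝ ∞ φ ∧ HasCompactSupport φ ∧ tsupport φ ⊆ I ∧ deriv φ = ψ := by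
  have hK : IsCompact (insert x₀ (tsupport ψ)) := hc.isCompact.insert x₀
  have hKI : insert x₀ (tsupport ψ) ⊆ I := insert_subset hx₀ hs
  obtain ⟨p, hp, hp'⟩ := hK.exists_isLeast ⟨x₀, mem_insert _ _⟩
  obtain ⟨q, hq, hq'⟩ := hK.exists_isGreatest ⟨x₀, mem_insert _ _⟩
  have hsupp {x : ℝ} (hx : ψ x ≠ 0) : p ≤ x ∧ x ≤ q :=
    have := mem_insert_of_mem x₀ (subset_tsupport _ hx)
    ⟨hp' this, hq' this⟩
  have hpq : p ≤ q := hp' hq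
  have hder : ∀ x, HasDerivAt (fun x => ∫ t in p..x, ψ t) (ψ x) x := fun x =>
    hψ.continuous.integral_hasStrictDerivAt p x |>.hasDerivAt
  have hderiv : deriv (fun x => ∫ t in p..x, ψ t) = ψ := funext fun x => (hder x).deriv
  have hsub : Function.support (fun x => ∫ t in p..x, ψ t) ⊆ Icc p q := by
    intro x hx
    by_contra hcon
    apply hx
    rw [mem_Icc, not_and_or, not_le, not_le] at hcon
    rcases hcon with h | h
    · refine intervalIntegral.integral_zero_ae ?_
      filter_upwards [compl_mem_ae_iff.2 (measure_singleton p)] with t ht htm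
      rw [uIoc_of_ge h.le] at htm
      by_contra h'
      exact ht (le_antisymm htm.2 (hsupp h').1)
    · have hae : ∀ᵐ t, t ∉ Ioc p x → ψ t = 0 := by
        filter_upwards [compl_mem_ae_iff.2 (measure_singleton p)] with t ht htm
        by_contra h'
        exact htm ⟨lt_of_le_of_ne (hsupp h').1 (Ne.symm ht), (hsupp h').2.trans h.le⟩
      change ∫ t in p..x, ψ t = 0
      rw [intervalIntegral.integral_of_le (hpq.trans h.le),
        setIntegral_eq_integral_of_ae_compl_eq_zero hae, h0]
  have hts : tsupport (fun x => ∫ t in p..x, ψ t) ⊆ Icc p q :=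
    closure_minimal hsub isClosed_Icc
  refine ⟨fun x => ∫ t in p..x, ψ t, ?_, ?_, hts.trans (hI.out (hKI hp) (hKI hq)), hderiv⟩
  · rw [contDiff_infty_iff_deriv, hderiv]
    exact ⟨fun x => (hder x).differentiableAt, hψ⟩
  · exact isCompact_Icc.of_isClosed_subset (isClosed_tsupport _) hts

/-- The du Bois-Reymond lemma. -/
lemma exists_ae_eq_const_of_integral_mul_deriv_eq_zero {I : Set ℝ} (hI : I.OrdConnected)
    (hIo : IsOpen I) {x₀ : ℝ} (hx₀ : x₀ ∈ I) {w : ℝ → ℝ} (hw : LocallyIntegrable w volume)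
    (h : ∀ φ : ℝ → ℝ, ContDiff ℝ ∞ φ → HasCompactSupport φ → tsupport φ ⊆ I →
      ∫ x, w x * deriv φ x = 0) :
    ∃ k : ℝ, ∀ᵐ x, x ∈ I → w x = k := by
  obtain ⟨ε, hε, hball⟩ := Metric.nhds_basis_closedBall.mem_iff.1 (hIo.mem_nhds hx₀)
  let B : ContDiffBump x₀ := ⟨ε / 2, ε, by positivity, by linarith⟩
  set ρ : ℝ → ℝ := B.normed volume with hρ
  have hρd : ContDiff ℝ ∞ ρ := B.contDiff_normed
  have hρc : HasCompactSupport ρ := B.hasCompactSupport_normed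
  have hρs : tsupport ρ ⊆ I := by
    rw [hρ, B.tsupport_normed_eq]; exact hball
  have hρ1 : ∫ x, ρ x = 1 := B.integral_normed
  have h_int {ψ : ℝ → ℝ} (hψ : ContDiff ℝ ∞ ψ) (hc : HasCompactSupport ψ) :
      Integrable (fun x => ψ x * w x) volume :=
    hw.integrable_smul_left_of_hasCompactSupport hψ.continuous hc
  have h_int1 {ψ : ℝ → ℝ} (hψ : ContDiff ℝ ∞ ψ) (hc : HasCompactSupport ψ) :
      Integrable ψ volume := hψ.continuous.integrable_of_hasCompactSupport hc
  set k := ∫ x, ρ x * w x with hk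
  refine ⟨k, ?_⟩
  have hloc : LocallyIntegrableOn (fun x => w x - k) I volume :=
    (hw.sub (locallyIntegrable_const k)).locallyIntegrableOn I
  have := hIo.ae_eq_zero_of_integral_contDiff_smul_eq_zero hloc ?_
  · filter_upwards [this] with x hx hxI
    exact sub_eq_zero.1 (hx hxI)
  intro ψ hψ hψc hψs
  set m := ∫ x, ψ x with hm
  have hcc : HasCompactSupport (fun x => m * ρ x) := hρc.mul_left
  obtain ⟨φ, hφ, hφc, hφs, hφd⟩ := exists_primitive_hasCompactSupport hI hx₀
    (ψ := fun x => ψ x - m * ρ x) (hψ.sub (contDiff_const.mul hρd))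
    (hψc.sub hcc)
    ((tsupport_sub _ _).trans (union_subset hψs
      ((tsupport_mul_subset_right (f := fun _ => m)).trans hρs)))
    (by rw [integral_sub (h_int1 hψ hψc) ((h_int1 hρd hρc).const_mul m), integral_const_mul, hρ1]
        simp [hm])
  have h1 := h φ hφ hφc hφs
  rw [hφd] at h1
  have h2 : ∫ x, w x * (ψ x - m * ρ x) = (∫ x, ψ x * w x) - m * k := by
    rw [hk, ← integral_const_mul, ← integral_sub (h_int hψ hψc) ((h_int hρd hρc).const_mul m)]
    congr 1 with x
    ring
  have h3 : ∫ x, ψ x • (w x - k) = (∫ x, ψ x * w x) - m * k := by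
    rw [hm, ← integral_mul_const, ← integral_sub (h_int hψ hψc) ((h_int1 hψ hψc).mul_const k)]
    congr 1 with x
    rw [smul_eq_mul]; ring
  rw [h3, ← h2, h1]

lemma IsWeakDerivOn.exists_ae_eq_primitive {I : Set ℝ} (hI : I.OrdConnected) (hIo : IsOpen I)
    {x₀ : ℝ} (hx₀ : x₀ ∈ I) {v g : ℝ → ℝ} (hv : MemLp v 2 (mGamma1.restrict I))
    (hg : MemLp g 2 (mGamma1.restrict I)) (h : IsWeakDerivOn I v g) :
    ∃ G : ℝ → ℝ, Measurable G ∧ LocallyIntegrable G volume ∧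
      G =ᵐ[volume.restrict I] g ∧
      ∃ k : ℝ, v =ᵐ[volume.restrict I] fun x => k + ∫ t in x₀..x, G t := by
  have hIm := hIo.measurableSet
  have hac : volume.restrict I ≪ mGamma1.restrict I :=
    volume_absolutelyContinuous_mGamma1.restrict I
  set G := I.indicator (hg.1.mk g) with hGdef
  have hGg : G =ᵐ[volume.restrict I] g :=
    (indicator_ae_eq_restrict hIm).trans (hac.ae_eq hg.1.ae_eq_mk).symm
  have hG : LocallyIntegrable G volume :=
    locallyIntegrable_indicator_of_memLp hIm ((memLp_congr_ae hg.1.ae_eq_mk).1 hg)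
  have hu : Continuous fun x => ∫ t in x₀..x, G t :=
    intervalIntegral.continuous_primitive
      (fun p q => (hG.integrableOn_isCompact isCompact_uIcc).intervalIntegrable) x₀
  have hV := locallyIntegrable_indicator_of_memLp hIm hv
  refine ⟨G, hg.1.stronglyMeasurable_mk.measurable.indicator hIm, hG, hGg, ?_⟩
  have hortho : ∀ φ : ℝ → ℝ, ContDiff ℝ ∞ φ → HasCompactSupport φ → tsupport φ ⊆ I →
      ∫ x, (I.indicator v x - ∫ t in x₀..x, G t) * deriv φ x = 0 := by
    intro φ hφ hφc hφs
    have hφ' : Continuous (deriv φ) := hφ.continuous_deriv (by norm_cast)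
    have e1 : ∫ x, I.indicator v x * deriv φ x = ∫ x in I, v x * deriv φ x := by
      rw [← integral_indicator hIm]
      simp_rw [indicator_mul_left]
    have e2 : ∫ x, G x * φ x = ∫ x in I, g x * φ x := by
      have : ∫ x, G x * φ x = ∫ x in I, G x * φ x := by
        rw [← integral_indicator hIm]
        congr 1 with x
        by_cases hx : x ∈ I <;> simp [hGdef, hx]
      rw [this]
      refine integral_congr_ae ?_
      filter_upwards [hGg] with x hx
      rw [hx]
    have e3 := integral_primitive_mul_deriv hG x₀ hφ hφc
    have i1 : Integrable (fun x => I.indicator v x * deriv φ x) volume :=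
      hV.integrable_smul_right_of_hasCompactSupport hφ' hφc.deriv
    have i2 : Integrable (fun x => (∫ t in x₀..x, G t) * deriv φ x) volume :=
      hu.locallyIntegrable.integrable_smul_right_of_hasCompactSupport hφ' hφc.deriv
    simp_rw [sub_mul]
    rw [integral_sub i1 i2, e1, e3, e2, h φ hφ hφc hφs, sub_self]
  obtain ⟨k, hk⟩ := exists_ae_eq_const_of_integral_mul_deriv_eq_zero hI hIo hx₀
    (hV.sub hu.locallyIntegrable) hortho
  refine ⟨k, (ae_restrict_iff' hIm).2 ?_⟩
  filter_upwards [hk] with x hx hxI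
  have := hx hxI
  rw [Pi.sub_apply, indicator_of_mem hxI] at this
  linarith

/-- The weighted Poincaré inequality with constant `c` on a set `J`, for the primitives vanishing
at `x₀`. -/
def PoincareFrom (x₀ : ℝ) (J : Set ℝ) (c : ℝ) : Prop :=
  ∀ G : ℝ → ℝ, Measurable G →
    ∫⁻ y in J, ENNReal.ofReal ((∫ t in x₀..y, G t) ^ 2 * gaussDensity1 y) ≤
      ENNReal.ofReal c * ∫⁻ t in J, ENNReal.ofReal (G t ^ 2 * gaussDensity1 t)

lemma PoincareFrom.mono {x₀ c d : ℝ} {J : Set ℝ} (h : PoincareFrom x₀ J c) (hcd : c ≤ d) :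
    PoincareFrom x₀ J d := fun G hG =>
  (h G hG).trans (by gcongr)

lemma setLIntegral_comp_neg (J : Set ℝ) (f : ℝ → ENNReal) :
    ∫⁻ y in Neg.neg ⁻¹' J, f (-y) = ∫⁻ y in J, f y :=
  (Measure.measurePreserving_neg (volume : Measure ℝ)).setLIntegral_comp_preimage_emb
    (MeasurableEquiv.neg ℝ).measurableEmbedding f J

lemma PoincareFrom.of_neg {x₀ c : ℝ} {J : Set ℝ}
    (h : PoincareFrom (-x₀) (Neg.neg ⁻¹' J) c) : PoincareFrom x₀ J c := by
  intro G hG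
  have := h (fun t => G (-t)) (hG.comp measurable_neg)
  rw [← setLIntegral_comp_neg J, ← setLIntegral_comp_neg J]
  simp only [gaussDensity1_neg]
  convert! this using 5 with y
  rw [intervalIntegral.integral_comp_neg, neg_neg, intervalIntegral.integral_symm, neg_sq]

/-- A weighted Cauchy-Schwarz inequality. -/
lemma ofReal_sq_integral_le {x₀ y : ℝ} (hy : x₀ ≤ y) {h H G : ℝ → ℝ} (hh : Continuous h)
    (hpos : ∀ t, x₀ < t → 0 < h t) (hder : ∀ t, HasDerivAt H (h t) t) (hH : H x₀ = 0)
    (hG : Measurable G) :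
    ENNReal.ofReal ((∫ t in x₀..y, G t) ^ 2) ≤
      (∫⁻ t in Ioc x₀ y, ENNReal.ofReal (G t ^ 2 / h t)) * ENNReal.ofReal (H y) := by
  have h_int : ∫⁻ t in Ioc x₀ y, ENNReal.ofReal (h t) = ENNReal.ofReal (H y) := by
    rw [← ofReal_integral_eq_lintegral_ofReal (hh.integrableOn_Ioc)
      ((ae_restrict_iff' measurableSet_Ioc).2 (ae_of_all _ fun t ht => (hpos t ht.1).le)),
      ← intervalIntegral.integral_of_le hy,
      intervalIntegral.integral_eq_sub_of_hasDerivAt (fun t _ => hder t)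
        (hh.intervalIntegrable _ _), hH, sub_zero]
  rw [← h_int]
  set f₁ : ℝ → ENNReal := fun t => ENNReal.ofReal (|G t| / √(h t)) with hf₁
  set f₂ : ℝ → ENNReal := fun t => ENNReal.ofReal (√(h t)) with hf₂
  have hm₁ : Measurable f₁ := by
    have := hh.measurable
    fun_prop
  have hm₂ : Measurable f₂ := by
    have := hh.measurable
    fun_prop
  have cs := ENNReal.lintegral_mul_le_Lp_mul_Lq (volume.restrict (Ioc x₀ y))
    Real.HolderConjugate.two_two hm₁.aemeasurable hm₂.aemeasurable
  have e0 : ∫⁻ t in Ioc x₀ y, ‖G t‖ₑ = ∫⁻ t in Ioc x₀ y, (f₁ * f₂) t := by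
    refine setLIntegral_congr_fun measurableSet_Ioc fun t ht => ?_
    have := hpos t ht.1
    simp only [Pi.mul_apply, hf₁, hf₂]
    rw [← ENNReal.ofReal_mul (by positivity), div_mul_cancel₀ _ (Real.sqrt_pos.2 this).ne',
      Real.enorm_eq_ofReal_abs]
  have e1 : ∫⁻ t in Ioc x₀ y, f₁ t ^ (2 : ℝ)
      = ∫⁻ t in Ioc x₀ y, ENNReal.ofReal (G t ^ 2 / h t) := by
    refine setLIntegral_congr_fun measurableSet_Ioc fun t ht => ?_
    have := hpos t ht.1
    simp only [hf₁]
    rw [ENNReal.rpow_two, ← ENNReal.ofReal_pow (by positivity), div_pow, sq_abs,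
      Real.sq_sqrt this.le]
  have e2 : ∫⁻ t in Ioc x₀ y, f₂ t ^ (2 : ℝ) = ∫⁻ t in Ioc x₀ y, ENNReal.ofReal (h t) := by
    refine setLIntegral_congr_fun measurableSet_Ioc fun t ht => ?_
    have := hpos t ht.1
    simp only [hf₂]
    rw [ENNReal.rpow_two, ← ENNReal.ofReal_pow (by positivity), Real.sq_sqrt this.le]
  rw [← e0, e1, e2] at cs
  have e3 : ENNReal.ofReal ((∫ t in x₀..y, G t) ^ 2) = ‖∫ t in x₀..y, G t‖ₑ ^ 2 := by
    rw [Real.enorm_eq_ofReal_abs, ← ENNReal.ofReal_pow (abs_nonneg _), sq_abs]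
  rw [e3]
  have e4 : ‖∫ t in x₀..y, G t‖ₑ ≤ ∫⁻ t in Ioc x₀ y, ‖G t‖ₑ := by
    rw [intervalIntegral.integral_of_le hy]
    exact enorm_integral_le_lintegral_enorm _
  calc ‖∫ t in x₀..y, G t‖ₑ ^ 2
      ≤ (_ * _) ^ 2 := by gcongr; exact e4.trans cs
    _ = _ := by
      rw [mul_pow, ← ENNReal.rpow_two, ← ENNReal.rpow_two, ← ENNReal.rpow_mul,
        ← ENNReal.rpow_mul]
      norm_num

/-- A sufficient condition for the Poincaré inequality to the right of `x₀`, in terms of an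
auxiliary increasing function `H` with derivative `h`. -/
lemma PoincareFrom.of_forall_setLIntegral_le {x₀ c : ℝ} {J : Set ℝ} (hJ : MeasurableSet J)
    (hJ₀ : ∀ y ∈ J, x₀ < y) (hJc : ∀ y ∈ J, Ioc x₀ y ⊆ J) {h H : ℝ → ℝ} (hh : Continuous h)
    (hpos : ∀ t, x₀ < t → 0 < h t) (hder : ∀ t, HasDerivAt H (h t) t) (hH : H x₀ = 0)
    (hc : 0 ≤ c)
    (key : ∀ t ∈ J, ∫⁻ y in J ∩ Ici t, ENNReal.ofReal (H y * gaussDensity1 y) ≤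
      ENNReal.ofReal (c * h t * gaussDensity1 t)) :
    PoincareFrom x₀ J c := by
  intro G hG
  set A : ℝ → ENNReal := fun t => ENNReal.ofReal (G t ^ 2 / h t) with hA
  set W : ℝ → ENNReal := fun y => ENNReal.ofReal (H y * gaussDensity1 y) with hW
  have hAm : Measurable A := by
    have := hh.measurable
    fun_prop
  have hWm : Measurable W := by
    have h1 : Continuous H := continuous_iff_continuousAt.2 fun t => (hder t).continuousAt
    have := (h1.mul continuous_gaussDensity1).measurable
    exact this.ennreal_ofReal
  set F : ℝ → ℝ → ENNReal := fun y t => (Iic y).indicator A t * W y with hF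
  have hFm : Measurable (Function.uncurry F) := by
    have : Measurable fun p : ℝ × ℝ => {p : ℝ × ℝ | p.2 ≤ p.1}.indicator (fun p => A p.2) p :=
      (hAm.comp measurable_snd).indicator (measurableSet_le measurable_snd measurable_fst)
    exact this.mul (hWm.comp measurable_fst)
  calc ∫⁻ y in J, ENNReal.ofReal ((∫ t in x₀..y, G t) ^ 2 * gaussDensity1 y)
      ≤ ∫⁻ y in J, ∫⁻ t in J, F y t := by
        refine setLIntegral_mono' hJ fun y hy => ?_
        have hHy : (∫⁻ t in Ioc x₀ y, A t) * W y ≤ ∫⁻ t in J, F y t := by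
          simp only [hF]
          rw [lintegral_mul_const _ (hAm.indicator measurableSet_Iic),
            lintegral_indicator measurableSet_Iic, Measure.restrict_restrict measurableSet_Iic]
          gcongr
          exact fun t ht => ⟨ht.2, hJc y hy ht⟩
        refine le_trans ?_ hHy
        rw [ENNReal.ofReal_mul (sq_nonneg _), hW]
        dsimp only
        rw [ENNReal.ofReal_mul' (gaussDensity1_pos y).le, ← mul_assoc]
        gcongr
        exact ofReal_sq_integral_le (hJ₀ y hy).le hh hpos hder hH hG
    _ = ∫⁻ t in J, ∫⁻ y in J, F y t := lintegral_lintegral_swap hFm.aemeasurable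
    _ ≤ ∫⁻ t in J, ENNReal.ofReal c * ENNReal.ofReal (G t ^ 2 * gaussDensity1 t) := by
        refine setLIntegral_mono' hJ fun t ht => ?_
        have e : ∀ y, F y t = A t * (Ici t).indicator W y := by
          intro y
          by_cases hty : t ≤ y <;> simp [hF, hty]
        simp_rw [e]
        rw [lintegral_const_mul _ (hWm.indicator measurableSet_Ici),
          lintegral_indicator measurableSet_Ici, Measure.restrict_restrict measurableSet_Ici,
          inter_comm]
        refine (mul_le_mul_right (key t ht) _).trans ?_
        have hp := hpos t (hJ₀ t ht)
        rw [hA]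
        dsimp only
        rw [← ENNReal.ofReal_mul (by positivity), ← ENNReal.ofReal_mul hc]
        refine (congrArg _ ?_).le
        field_simp
    _ = _ := lintegral_const_mul' _ _ ENNReal.ofReal_ne_top

lemma tendsto_add_mul_gaussDensity1 (k : ℝ) :
    Tendsto (fun y => (y + k) * gaussDensity1 y) atTop (𝓝 0) := by
  have h0 := (Real.tendsto_pow_mul_exp_neg_atTop_nhds_zero 1).const_mul (Real.exp 1)
  have h1 := (Real.tendsto_pow_mul_exp_neg_atTop_nhds_zero 0).const_mul (|k| * Real.exp 1)
  have h := h0.add h1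
  simp only [mul_zero, add_zero] at h
  refine squeeze_zero_norm' ?_ h
  filter_upwards [eventually_ge_atTop 0] with y hy
  have hg : gaussDensity1 y ≤ Real.exp 1 * Real.exp (-y) := by
    rw [gaussDensity1, ← Real.exp_add]
    exact Real.exp_le_exp.2 (by nlinarith [sq_nonneg (y - 1)])
  have hg0 := (gaussDensity1_pos y).le
  calc ‖(y + k) * gaussDensity1 y‖ = |y + k| * gaussDensity1 y := by
        rw [norm_mul, Real.norm_eq_abs, Real.norm_of_nonneg hg0]
    _ ≤ (y + |k|) * (Real.exp 1 * Real.exp (-y)) := by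
        gcongr
        exact (abs_add_le y k).trans (by rw [abs_of_nonneg hy])
    _ = _ := by ring

/-- Tail bound from a decreasing primitive vanishing at infinity. -/
lemma setLIntegral_Ici_le {t : ℝ} {p P : ℝ → ℝ} (hder : ∀ y, HasDerivAt P (-p y) y)
    (hp : ∀ y, t < y → 0 ≤ p y) (hP : Tendsto P atTop (𝓝 0)) :
    ∫⁻ y in Ici t, ENNReal.ofReal (p y) ≤ ENNReal.ofReal (P t) := by
  rw [setLIntegral_congr Ioi_ae_eq_Ici.symm]
  have hi := integrableOn_Ioi_deriv_of_nonpos' (a := t) (fun y _ => hder y)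
    (fun y hy => neg_nonpos.2 (hp y hy)) hP
  have he := integral_Ioi_of_hasDerivAt_of_nonpos' (a := t) (fun y _ => hder y)
    (fun y hy => neg_nonpos.2 (hp y hy)) hP
  rw [integral_neg, zero_sub, neg_inj] at he
  rw [← he, ofReal_integral_eq_lintegral_ofReal]
  · simpa using! hi.neg
  · exact (ae_restrict_iff' measurableSet_Ioi).2 (ae_of_all _ hp)

lemma poincareFrom_zero {J : Set ℝ} (hJ : MeasurableSet J) (hJ₀ : ∀ y ∈ J, 0 < y)
    (hJc : ∀ y ∈ J, Ioc 0 y ⊆ J) : PoincareFrom 0 J 1 := by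
  refine PoincareFrom.of_forall_setLIntegral_le hJ hJ₀ hJc (h := fun _ => 1) (H := fun y => y)
    continuous_const (fun _ _ => one_pos) hasDerivAt_id' rfl zero_le_one fun t ht => ?_
  refine (lintegral_mono_set inter_subset_right).trans ?_
  have ht0 := hJ₀ t ht
  rw [mul_one, one_mul]
  refine setLIntegral_Ici_le (fun y => ?_)
    (fun y hy => mul_nonneg (ht0.trans hy).le (gaussDensity1_pos y).le) ?_
  · simpa using! hasDerivAt_gaussDensity1 y
  · have := (tendsto_add_mul_gaussDensity1 1).sub (tendsto_add_mul_gaussDensity1 0)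
    rw [sub_zero] at this
    exact this.congr fun y => by ring

lemma poincareFrom_of_pos {x₀ : ℝ} (hx₀ : 0 < x₀) {J : Set ℝ} (hJ : MeasurableSet J)
    (hJ₀ : ∀ y ∈ J, x₀ < y) (hJc : ∀ y ∈ J, Ioc x₀ y ⊆ J) :
    PoincareFrom x₀ J ((x₀ ^ 2 + 1) / (2 * x₀ ^ 2 + 1)) := by
  set k := 1 / x₀ with hk
  have hk0 : 0 < k := by positivity
  have hkx : k * x₀ = 1 := by rw [hk]; field_simp
  refine PoincareFrom.of_forall_setLIntegral_le hJ hJ₀ hJc (h := fun y => 2 * y + k)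
    (H := fun y => y ^ 2 + k * y - (x₀ ^ 2 + 1)) (by fun_prop) (fun t ht => ?_) (fun t => ?_)
    (by simp only [hkx]; ring) (by positivity) fun t ht => ?_
  · have := hx₀.trans ht
    positivity
  · convert! (((hasDerivAt_pow 2 t).add ((hasDerivAt_id' t).const_mul k)).sub_const _) using 1
    norm_num
  have ht0 := hJ₀ t ht
  calc ∫⁻ y in J ∩ Ici t, ENNReal.ofReal ((y ^ 2 + k * y - (x₀ ^ 2 + 1)) * gaussDensity1 y)
      ≤ ∫⁻ y in Ici t, ENNReal.ofReal ((y ^ 2 + k * y - (x₀ ^ 2 + 1)) * gaussDensity1 y) :=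
        lintegral_mono_set inter_subset_right
    _ ≤ ∫⁻ y in Ici t, ENNReal.ofReal ((y ^ 2 + k * y - 1) * gaussDensity1 y) := by
        refine lintegral_mono fun y => ENNReal.ofReal_le_ofReal ?_
        have := (gaussDensity1_pos y).le
        gcongr
        nlinarith
    _ ≤ ENNReal.ofReal ((t + k) * gaussDensity1 t) := by
        refine setLIntegral_Ici_le (P := fun y => (y + k) * gaussDensity1 y) (fun y => ?_)
          (fun y hy => mul_nonneg ?_ (gaussDensity1_pos y).le) (tendsto_add_mul_gaussDensity1 k)
        · convert! ((hasDerivAt_id' y).add_const k).mul (hasDerivAt_gaussDensity1 y) using 1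
          ring
        · nlinarith [mul_pos hk0 (sub_pos.2 (ht0.trans hy))]
    _ ≤ _ := by
        refine ENNReal.ofReal_le_ofReal ?_
        have := (gaussDensity1_pos t).le
        gcongr
        rw [div_mul_eq_mul_div, le_div_iff₀ (by positivity)]
        have h1 : x₀ ^ 2 * k = x₀ := by rw [sq, mul_assoc, mul_comm x₀ k, hkx, mul_one]
        nlinarith

lemma poincareFrom_Ioo {x₀ b : ℝ} (hδ : -x₀ * (b - x₀) ≤ gaussDensity1 b / 2) :
    PoincareFrom x₀ (Ioo x₀ b) (1 - gaussDensity1 b / 2) := by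
  have hb1 := gaussDensity1_le_one b
  have hb0 := gaussDensity1_pos b
  refine PoincareFrom.of_forall_setLIntegral_le measurableSet_Ioo (fun y hy => hy.1)
    (fun y hy t ht => ⟨ht.1, ht.2.trans_lt hy.2⟩) (h := fun _ => 1) (H := fun y => y - x₀)
    continuous_const (fun _ _ => one_pos) (fun t => (hasDerivAt_id' t).sub_const _) (sub_self _)
    (by linarith) fun t ht => ?_
  set δ := max (-x₀) 0 with hδdef
  have hδ0 : 0 ≤ δ := le_max_right _ _
  have hδx : -x₀ ≤ δ := le_max_left _ _
  have hδb : δ * (b - t) ≤ gaussDensity1 b / 2 := by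
    have h1 : δ * (b - t) ≤ δ * (b - x₀) := by gcongr; exact ht.1.le
    refine h1.trans ?_
    rcases max_cases (-x₀) 0 with h | h <;> rw [hδdef, h.1]
    · exact hδ
    · rw [zero_mul]; positivity
  have hcont : Continuous fun y => (y - x₀) * gaussDensity1 y :=
    (continuous_id.sub continuous_const).mul continuous_gaussDensity1
  have hcont' : Continuous fun y => y * gaussDensity1 y + δ :=
    (continuous_id.mul continuous_gaussDensity1).add continuous_const
  calc ∫⁻ y in Ioo x₀ b ∩ Ici t, ENNReal.ofReal ((y - x₀) * gaussDensity1 y)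
      ≤ ∫⁻ y in Icc t b, ENNReal.ofReal ((y - x₀) * gaussDensity1 y) :=
        lintegral_mono_set fun y hy => ⟨hy.2, hy.1.2.le⟩
    _ = ENNReal.ofReal (∫ y in t..b, (y - x₀) * gaussDensity1 y) := by
        rw [intervalIntegral.integral_of_le ht.2.le, ← integral_Icc_eq_integral_Ioc,
          ofReal_integral_eq_lintegral_ofReal hcont.integrableOn_Icc]
        exact (ae_restrict_iff' measurableSet_Icc).2 (ae_of_all _ fun y hy =>
          mul_nonneg (sub_nonneg.2 (ht.1.le.trans hy.1)) (gaussDensity1_pos y).le)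
    _ ≤ ENNReal.ofReal ((1 - gaussDensity1 b / 2) * 1 * gaussDensity1 t) := by
        refine ENNReal.ofReal_le_ofReal ?_
        have h1 : ∫ y in t..b, (y - x₀) * gaussDensity1 y ≤
            ∫ y in t..b, (y * gaussDensity1 y + δ) := by
          refine intervalIntegral.integral_mono_on ht.2.le (hcont.intervalIntegrable _ _)
            (hcont'.intervalIntegrable _ _) fun y _ => ?_
          have hy0 := gaussDensity1_pos y
          have hy1 := gaussDensity1_le_one y
          nlinarith [mul_le_mul_of_nonneg_right hδx hy0.le, mul_le_mul_of_nonneg_left hy1 hδ0]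
        have h2 : ∫ y in t..b, (y * gaussDensity1 y + δ) =
            (-gaussDensity1 b + δ * b) - (-gaussDensity1 t + δ * t) := by
          refine intervalIntegral.integral_eq_sub_of_hasDerivAt
            (f := fun y => -gaussDensity1 y + δ * y) (fun y _ => ?_)
            (hcont'.intervalIntegrable _ _)
          convert! (hasDerivAt_gaussDensity1 y).neg.add ((hasDerivAt_id' y).const_mul δ) using 1
          ring
        have ht1 := gaussDensity1_le_one t
        nlinarith

lemma ofReal_setIntegral_mGamma1 {I : Set ℝ} (hI : MeasurableSet I) {f : ℝ → ℝ}
    (hf : MemLp f 2 (mGamma1.restrict I)) :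
    ENNReal.ofReal (∫ x in I, f x ^ 2 ∂mGamma1) =
      ∫⁻ x in I, ENNReal.ofReal (f x ^ 2 * gaussDensity1 x) := by
  rw [ofReal_integral_eq_lintegral_ofReal hf.integrable_sq (ae_of_all _ fun x => sq_nonneg _),
    mGamma1, setLIntegral_withDensity_eq_setLIntegral_mul_non_measurable _
      continuous_gaussDensity1.measurable.ennreal_ofReal _ hI
      (ae_of_all _ fun x => ENNReal.ofReal_lt_top)]
  refine lintegral_congr fun x => ?_
  rw [Pi.mul_apply, ← ENNReal.ofReal_mul (gaussDensity1_pos x).le, mul_comm]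

lemma setLIntegral_eq_Iio_add_Ioi (I : Set ℝ) (x₀ : ℝ) (f : ℝ → ENNReal) :
    ∫⁻ x in I, f x = (∫⁻ x in I ∩ Iio x₀, f x) + ∫⁻ x in I ∩ Ioi x₀, f x := by
  have h : (I \ Iio x₀ : Set ℝ) =ᵐ[volume] (I ∩ Ioi x₀ : Set ℝ) := by
    rw [sdiff_eq, compl_Iio]
    exact (ae_eq_refl I).inter Ioi_ae_eq_Ici.symm
  rw [← setLIntegral_congr h, lintegral_inter_add_sdiff _ _ measurableSet_Iio]

/-- The Poincaré inequality on an interval, from the Poincaré inequalities on both sides of one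
of its points. -/
lemma IsWeakDerivOn.setIntegral_sq_le {I : Set ℝ} (hI : I.OrdConnected) (hIo : IsOpen I)
    {x₀ : ℝ} (hx₀ : x₀ ∈ I) {c : ℝ} (hc : 0 ≤ c) (hL : PoincareFrom x₀ (I ∩ Iio x₀) c)
    (hR : PoincareFrom x₀ (I ∩ Ioi x₀) c) {v g : ℝ → ℝ} (hv : MemLp v 2 (mGamma1.restrict I))
    (hg : MemLp g 2 (mGamma1.restrict I)) (h : IsWeakDerivOn I v g)
    (h0 : ∫ x in I, v x ∂mGamma1 = 0) :
    ∫ x in I, v x ^ 2 ∂mGamma1 ≤ c * ∫ x in I, g x ^ 2 ∂mGamma1 := by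
  have hIm := hIo.measurableSet
  obtain ⟨G, hGm, -, hGg, k, hk⟩ := h.exists_ae_eq_primitive hI hIo hx₀ hv hg
  have hvk : MemLp (fun x => v x - k) 2 (mGamma1.restrict I) := hv.sub (memLp_const k)
  have h1 : ∫ x in I, v x ^ 2 ∂mGamma1 ≤ ∫ x in I, (v x - k) ^ 2 ∂mGamma1 := by
    have hi : Integrable v (mGamma1.restrict I) := hv.integrable (by norm_num)
    have e : ∀ x, (v x - k) ^ 2 = v x ^ 2 - 2 * k * v x + k ^ 2 := fun x => by ring
    simp_rw [e]
    have hs : Integrable (fun x => v x ^ 2 - 2 * k * v x) (mGamma1.restrict I) :=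
      hv.integrable_sq.sub (hi.const_mul _)
    rw [integral_add hs (integrable_const _),
      integral_sub hv.integrable_sq (hi.const_mul _), integral_const_mul, h0, mul_zero, sub_zero]
    exact le_add_of_nonneg_right (integral_nonneg fun x => sq_nonneg k)
  refine h1.trans ((ENNReal.ofReal_le_ofReal_iff
    (mul_nonneg hc (integral_nonneg fun x => sq_nonneg _))).1 ?_)
  rw [ENNReal.ofReal_mul hc, ofReal_setIntegral_mGamma1 hIm hvk, ofReal_setIntegral_mGamma1 hIm hg]
  calc ∫⁻ x in I, ENNReal.ofReal ((v x - k) ^ 2 * gaussDensity1 x)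
      = ∫⁻ x in I, ENNReal.ofReal ((∫ t in x₀..x, G t) ^ 2 * gaussDensity1 x) := by
        refine lintegral_congr_ae ?_
        filter_upwards [hk] with x hx
        rw [hx, add_sub_cancel_left]
    _ ≤ ENNReal.ofReal c * ∫⁻ x in I, ENNReal.ofReal (G x ^ 2 * gaussDensity1 x) := by
        rw [setLIntegral_eq_Iio_add_Ioi I x₀, setLIntegral_eq_Iio_add_Ioi I x₀, mul_add]
        exact add_le_add (hL G hGm) (hR G hGm)
    _ = _ := by
        congr 1
        refine lintegral_congr_ae ?_
        filter_upwards [hGg] with x hx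
        rw [hx]

lemma isOpen_erealIoo (a b : EReal) : IsOpen (erealIoo a b) :=
  isOpen_Ioo.preimage continuous_coe_real_ereal

lemma ordConnected_erealIoo (a b : EReal) : (erealIoo a b).OrdConnected :=
  ⟨fun _ hx _ hy _ hz => ⟨hx.1.trans_le (EReal.coe_le_coe_iff.2 hz.1),
    (EReal.coe_le_coe_iff.2 hz.2).trans_lt hy.2⟩⟩

lemma neg_preimage_erealIoo (a b : EReal) : Neg.neg ⁻¹' erealIoo a b = erealIoo (-b) (-a) := by
  ext x
  simp only [erealIoo, mem_preimage, mem_ofPred_eq, EReal.coe_neg]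
  rw [EReal.lt_neg_comm, EReal.neg_lt_comm, and_comm]

/-- A point of `(a,b)` from which the Poincaré inequality holds on both sides with the
constant `c`. -/
def HasPoincarePoint (a b : EReal) (c : ℝ) : Prop :=
  ∃ x₀ ∈ erealIoo a b, PoincareFrom x₀ (erealIoo a b ∩ Iio x₀) c ∧
    PoincareFrom x₀ (erealIoo a b ∩ Ioi x₀) c

lemma HasPoincarePoint.of_neg {a b : EReal} {c : ℝ} (h : HasPoincarePoint (-b) (-a) c) :
    HasPoincarePoint a b c := by
  obtain ⟨x₀, hx₀, hL, hR⟩ := h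
  rw [← neg_preimage_erealIoo] at hx₀ hL hR
  refine ⟨-x₀, hx₀, .of_neg ?_, .of_neg ?_⟩
  · rw [neg_neg, preimage_inter]
    convert! hR using 2
    ext x
    simp
  · rw [neg_neg, preimage_inter]
    convert! hL using 2
    ext x
    simp

lemma Ioc_subset_erealIoo_inter_Ioi {a b : EReal} {x₀ : ℝ} (hx₀ : x₀ ∈ erealIoo a b) :
    ∀ y ∈ erealIoo a b ∩ Ioi x₀, Ioc x₀ y ⊆ erealIoo a b ∩ Ioi x₀ := fun _ hy _ ht =>
  ⟨(ordConnected_erealIoo a b).out hx₀ hy.1 ⟨ht.1.le, ht.2⟩, ht.1⟩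

lemma hasPoincarePoint_univ : HasPoincarePoint ⊥ ⊤ 1 := by
  have h0 (x : ℝ) : x ∈ erealIoo ⊥ ⊤ := ⟨EReal.bot_lt_coe x, EReal.coe_lt_top x⟩
  have hR : PoincareFrom 0 (erealIoo ⊥ ⊤ ∩ Ioi 0) 1 :=
    poincareFrom_zero ((isOpen_erealIoo _ _).measurableSet.inter measurableSet_Ioi)
      (fun y hy => hy.2) (Ioc_subset_erealIoo_inter_Ioi (h0 0))
  refine ⟨0, h0 0, .of_neg ?_, hR⟩
  rw [neg_zero, preimage_inter, neg_preimage_erealIoo]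
  convert! hR using 2
  ext x
  simp

lemma exists_hasPoincarePoint_of_coe {a : ℝ} {b : EReal} (hab : (a : EReal) < b) (hb : 0 < b) :
    ∃ c, 0 < c ∧ c < 1 ∧ HasPoincarePoint a b c := by
  have hm : ((max a 0 : ℝ) : EReal) < b := by
    rcases max_choice a 0 with h | h <;> rw [h]
    exacts [hab, hb]
  have e1 : ∀ᶠ x : ℝ in 𝓝[>] (max a 0), (x : EReal) < b :=
    ((continuous_coe_real_ereal.tendsto _).eventually_lt_const hm).filter_mono
      nhdsWithin_le_nhds
  have e2 : ∀ᶠ x : ℝ in 𝓝[>] (max a 0), x * (x - a) < gaussDensity1 a / 2 := by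
    have hcont : Continuous fun x : ℝ => x * (x - a) := by fun_prop
    refine ((hcont.tendsto _).eventually_lt_const ?_).filter_mono nhdsWithin_le_nhds
    have := gaussDensity1_pos a
    rcases max_choice a 0 with h | h <;> rw [h] <;> simp [this]
  obtain ⟨x₀, h1, h2, h3⟩ := (e1.and (e2.and self_mem_nhdsWithin)).exists
  have hax : a < x₀ := (le_max_left a 0).trans_lt h3
  have h0x : 0 < x₀ := (le_max_right a 0).trans_lt h3
  have hmem : x₀ ∈ erealIoo a b := ⟨EReal.coe_lt_coe_iff.2 hax, h1⟩
  refine ⟨max (1 - gaussDensity1 a / 2) ((x₀ ^ 2 + 1) / (2 * x₀ ^ 2 + 1)),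
    lt_max_of_lt_right (by positivity), max_lt ?_ ?_, x₀, hmem, ?_, ?_⟩
  · linarith [gaussDensity1_pos a]
  · rw [div_lt_one (by positivity)]
    nlinarith
  · refine PoincareFrom.mono (.of_neg ?_) (le_max_left _ _)
    rw [preimage_inter, neg_preimage_erealIoo, ← gaussDensity1_neg a]
    convert! poincareFrom_Ioo (x₀ := -x₀) (b := -a) ?_ using 1
    · ext x
      simp only [erealIoo, mem_inter_iff, mem_preimage, mem_ofPred_eq, mem_Iio, mem_Ioo,
        ← EReal.coe_neg, EReal.coe_lt_coe_iff]
      constructor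
      · rintro ⟨⟨-, h⟩, h'⟩
        exact ⟨by linarith, h⟩
      · rintro ⟨h, h'⟩
        refine ⟨⟨?_, h'⟩, by linarith⟩
        refine (EReal.neg_lt_neg_iff.2 h1).trans ?_
        exact_mod_cast h
    · rw [gaussDensity1_neg]
      linarith
  · exact PoincareFrom.mono (poincareFrom_of_pos h0x
      ((isOpen_erealIoo _ _).measurableSet.inter measurableSet_Ioi)
      (fun y hy => hy.2) (Ioc_subset_erealIoo_inter_Ioi hmem)) (le_max_right _ _)

lemma exists_hasPoincarePoint_lt_one {a b : EReal} (hab : a < b) (h : ¬(a = ⊥ ∧ b = ⊤)) :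
    ∃ c, 0 < c ∧ c < 1 ∧ HasPoincarePoint a b c := by
  have key {b : ℝ} {a : EReal} (hab : a < b) (ha : a < 0) :
      ∃ c, 0 < c ∧ c < 1 ∧ HasPoincarePoint a b c := by
    obtain ⟨c, h0, h1, hc⟩ := exists_hasPoincarePoint_of_coe (a := -b) (b := -a)
      (by rw [EReal.coe_neg]; exact EReal.neg_lt_neg_iff.2 hab)
      (by rwa [EReal.lt_neg_comm, neg_zero])
    rw [EReal.coe_neg] at hc
    exact ⟨c, h0, h1, hc.of_neg⟩
  induction b with
  | bot => exact absurd hab not_lt_bot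
  | top =>
    induction a with
    | bot => exact absurd ⟨rfl, rfl⟩ h
    | top => exact absurd hab (lt_irrefl _)
    | coe a => exact exists_hasPoincarePoint_of_coe hab EReal.zero_lt_top
  | coe b =>
    induction a with
    | bot => exact key hab EReal.bot_lt_zero
    | top => exact absurd hab not_top_lt
    | coe a =>
      by_cases hb : (0 : EReal) < b
      · exact exists_hasPoincarePoint_of_coe hab hb
      · exact key hab (hab.trans_le (not_lt.1 hb))

lemma isWeakDerivOn_sub_const {I : Set ℝ} (m : ℝ) :
    IsWeakDerivOn I (fun x => x - m) fun _ => 1 := by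
  intro φ hφ hc hs
  have hz {x : ℝ} (hx : x ∉ I) : x ∉ tsupport φ := fun h => hx (hs h)
  rw [setIntegral_eq_integral_of_forall_compl_eq_zero,
    setIntegral_eq_integral_of_forall_compl_eq_zero]
  · simpa using integral_primitive_mul_deriv (G := fun _ => 1) (locallyIntegrable_const 1) m hφ hc
  · intro x hx
    rw [image_eq_zero_of_notMem_tsupport (hz hx), mul_zero]
  · intro x hx
    rw [image_eq_zero_of_notMem_tsupport fun h => hz hx (tsupport_deriv_subset h), mul_zero]

lemma not_sub_const_ae_eq_zero {I : Set ℝ} (hIo : IsOpen I) (hne : I.Nonempty) (m : ℝ) :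
    ¬ (fun x => x - m) =ᵐ[mGamma1.restrict I] fun _ => (0 : ℝ) := by
  intro h
  have h1 : ∀ᵐ x ∂volume.restrict I, x = m := by
    filter_upwards [(volume_absolutelyContinuous_mGamma1.restrict I).ae_le h] with x hx
    exact sub_eq_zero.1 hx
  have h2 : ∀ᵐ x ∂volume.restrict I, x ≠ m :=
    ae_restrict_of_ae (compl_mem_ae_iff.2 (measure_singleton m))
  have h3 : ∀ᵐ _ ∂volume.restrict I, False := by
    filter_upwards [h1, h2] with x hx hx'
    exact hx' hx
  rw [eventually_false_iff_eq_bot, ae_eq_bot, Measure.restrict_eq_zero] at h3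
  exact (hIo.measure_pos volume hne).ne' h3

lemma erealIoo_nonempty {a b : EReal} (hab : a < b) : (erealIoo a b).Nonempty := by
  obtain ⟨x, h1, h2⟩ := EReal.lt_iff_exists_real_btwn.1 hab
  exact ⟨x, h1, h2⟩

lemma measureReal_mGamma1_pos {I : Set ℝ} (hIo : IsOpen I) (hne : I.Nonempty) :
    0 < mGamma1.real I :=
  ENNReal.toReal_pos (fun h => (hIo.measure_pos volume hne).ne'
    (volume_absolutelyContinuous_mGamma1 h)) (measure_ne_top _ _)

/-- For all `-∞ ≤ a < b ≤ +∞` one has `μ₁(a,b) ≥ 1`, with equality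
if and only if `(a,b) = ℝ`. -/
theorem mu1D_ge_one_eq_iff (a b : EReal) (hab : a < b) :
    1 ≤ mu1D a b ∧ (mu1D a b = 1 ↔ a = ⊥ ∧ b = ⊤) := by
  have hIo := isOpen_erealIoo a b
  have hne := erealIoo_nonempty hab
  set S := { r : ℝ | ∃ v g, MemLp v 2 (mGamma1.restrict (erealIoo a b)) ∧
    MemLp g 2 (mGamma1.restrict (erealIoo a b)) ∧
    IsWeakDerivOn (erealIoo a b) v g ∧
    ¬ v =ᵐ[mGamma1.restrict (erealIoo a b)] (fun _ => (0 : ℝ)) ∧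
    (∫ x in erealIoo a b, v x ∂mGamma1) = 0 ∧
    r = (∫ x in erealIoo a b, (g x) ^ 2 ∂mGamma1) /
        (∫ x in erealIoo a b, (v x) ^ 2 ∂mGamma1) } with hS
  have hmu : mu1D a b = sInf S := rfl
  have hmem (m : ℝ) (hm : ∫ x in erealIoo a b, (x - m) ∂mGamma1 = 0) :
      (∫ _ in erealIoo a b, (1 : ℝ) ^ 2 ∂mGamma1) /
        (∫ x in erealIoo a b, (x - m) ^ 2 ∂mGamma1) ∈ S :=
    ⟨fun x => x - m, fun _ => 1, (memLp_id_mGamma1.restrict _).sub (memLp_const m),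
      memLp_const 1, isWeakDerivOn_sub_const m, not_sub_const_ae_eq_zero hIo hne m, hm, rfl⟩
  have hSne : S.Nonempty := by
    refine ⟨_, hmem ((∫ x in erealIoo a b, x ∂mGamma1) / mGamma1.real (erealIoo a b)) ?_⟩
    rw [integral_sub ((memLp_id_mGamma1.restrict _).integrable (by norm_num))
      (integrable_const _), setIntegral_const, smul_eq_mul,
      mul_div_cancel₀ _ (measureReal_mGamma1_pos hIo hne).ne', sub_self]
  have hbound {c : ℝ} (hc : 0 < c) (h : HasPoincarePoint a b c) : 1 / c ≤ mu1D a b := by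
    obtain ⟨x₀, hx₀, hL, hR⟩ := h
    rw [hmu]
    refine le_csInf hSne ?_
    rintro r ⟨v, g, hv, hg, hw, hv0, hmean, rfl⟩
    have hpos : 0 < ∫ x in erealIoo a b, v x ^ 2 ∂mGamma1 := by
      refine (integral_nonneg fun x => sq_nonneg (v x)).lt_of_ne fun h => hv0 ?_
      filter_upwards [(integral_eq_zero_iff_of_nonneg (fun x => sq_nonneg (v x))
        hv.integrable_sq).1 h.symm] with x hx
      exact pow_eq_zero_iff two_ne_zero |>.1 hx
    rw [div_le_div_iff₀ hc hpos, one_mul, mul_comm _ c]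
    exact hw.setIntegral_sq_le (ordConnected_erealIoo a b) hIo hx₀ hc.le hL hR hv hg hmean
  by_cases h : a = ⊥ ∧ b = ⊤
  · have h1 : 1 ≤ mu1D a b := by
      have := hbound one_pos (by rw [h.1, h.2]; exact hasPoincarePoint_univ)
      rwa [div_one] at this
    refine ⟨h1, fun _ => h, fun _ => h1.antisymm' ?_⟩
    have huniv : erealIoo a b = univ := by
      rw [h.1, h.2]
      exact eq_univ_of_forall fun x => ⟨EReal.bot_lt_coe x, EReal.coe_lt_top x⟩
    have hone := hmem 0 (by simpa [huniv] using integral_id_mGamma1)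
    have hZ : 0 < mGamma1.real univ := measureReal_mGamma1_pos isOpen_univ univ_nonempty
    rw [huniv, Measure.restrict_univ] at hone
    simp only [sub_zero] at hone
    rw [integral_sq_mGamma1, div_self (by simpa using hZ.ne')] at hone
    refine csInf_le ⟨0, ?_⟩ hone
    rintro r ⟨v, g, -, -, -, -, -, rfl⟩
    exact div_nonneg (integral_nonneg fun x => sq_nonneg _) (integral_nonneg fun x => sq_nonneg _)
  · obtain ⟨c, h0, h1, hc⟩ := exists_hasPoincarePoint_lt_one hab h
    have hlt : 1 < mu1D a b := ((one_lt_div h0).2 h1).trans_le (hbound h0 hc)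
    exact ⟨hlt.le, fun he => absurd he hlt.ne', fun he => absurd he h⟩
end

section
/- Let L, r > 0 and (x₀,y₀) ∈ ℝ², and let β : [x₀−r, x₀+r] → [0,+∞) be an L-Lipschitz function with |β(x) − y₀| < r/2 for all x. Set Ωᵉ = {(x,y) : |x−x₀| < r, β(x) < y < y₀ + r} and D = {(x,y) : |x−x₀| < r, 2β(x) − (y₀ + r) < y < β(x)} (the image of Ωᵉ under the reflection R(x,y) = (x, 2β(x) − y)). Let u be continuously differentiable on an open neighbourhood of the closure of D and define uᵉ(x,y) = u(x, 2β(x) − y) for (x,y) ∈ Ωᵉ (a Lipschitz function, whose gradient exists almost everywhere). Then ∫_{Ωᵉ} (uᵉ)² dm_γ ≤ ∫_D u² dm_γ, and there exists a constant C(L) > 0 depending only on L such that ∫_{Ωᵉ} |∇uᵉ|² dm_γ ≤ C(L) ∫_D |∇u|² dm_γ. -/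
open MeasureTheory Real Set Filter Topology

/-- The planar Gaussian density `γ(x,y) = exp(-(x²+y²)/2)`. -/
noncomputable def gaussDensity (z : ℝ × ℝ) : ℝ := Real.exp (-(z.1 ^ 2 + z.2 ^ 2) / 2)

/-- The Gaussian measure `dm_γ = γ(x,y) dx dy` on `ℝ²`. -/
noncomputable def mGamma : Measure (ℝ × ℝ) :=
  volume.withDensity fun z => ENNReal.ofReal (gaussDensity z)

/-- `g` is the distributional gradient of `u` on the open set `Ω`. -/
def IsWeakGradOn (Ω : Set (ℝ × ℝ)) (u : ℝ × ℝ → ℝ) (g : ℝ × ℝ → ℝ × ℝ) : Prop :=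
  ∀ φ : ℝ × ℝ → ℝ, ContDiff ℝ (⊤ : ℕ∞) φ → HasCompactSupport φ → tsupport φ ⊆ Ω →
    ((∫ z in Ω, u z * fderiv ℝ φ z (1, 0)) = -∫ z in Ω, (g z).1 * φ z) ∧
    ((∫ z in Ω, u z * fderiv ℝ φ z (0, 1)) = -∫ z in Ω, (g z).2 * φ z)

/-- `u ∈ H¹_γ(Ω)` with distributional gradient `g`. -/
def MemH1gamma (Ω : Set (ℝ × ℝ)) (u : ℝ × ℝ → ℝ) (g : ℝ × ℝ → ℝ × ℝ) : Prop :=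
  MemLp u 2 (mGamma.restrict Ω) ∧
    MemLp (fun z => ‖g z‖) 2 (mGamma.restrict Ω) ∧
    IsWeakGradOn Ω u g

/-- The first nontrivial Neumann eigenvalue of the Hermite operator on `Ω`. -/
noncomputable def mu1 (Ω : Set (ℝ × ℝ)) : ℝ :=
  sInf { r : ℝ | ∃ u g, MemH1gamma Ω u g ∧
    ¬ u =ᵐ[mGamma.restrict Ω] (fun _ => (0 : ℝ)) ∧
    (∫ z in Ω, u z ∂mGamma) = 0 ∧
    r = (∫ z in Ω, ((g z).1 ^ 2 + (g z).2 ^ 2) ∂mGamma) /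
        (∫ z in Ω, (u z) ^ 2 ∂mGamma) }


/-- The vertical reflection `(x, y) ↦ (x, 2 b(x) - y)` across the graph of `b`. -/
def graphReflection (b : ℝ → ℝ) (z : ℝ × ℝ) : ℝ × ℝ := (z.1, 2 * b z.1 - z.2)

lemma graphReflection_involutive (b : ℝ → ℝ) : Function.Involutive (graphReflection b) := by
  intro z
  simp [graphReflection]

lemma measurable_graphReflection {b : ℝ → ℝ} (hb : Measurable b) :
    Measurable (graphReflection b) := by
  unfold graphReflection
  fun_prop

lemma measurePreserving_graphReflection {b : ℝ → ℝ} (hb : Measurable b) :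
    MeasurePreserving (graphReflection b) volume volume :=
  (MeasurePreserving.id (volume : Measure ℝ)).skew_product
    (g := fun x y => 2 * b x - y) (by unfold Function.uncurry; fun_prop)
    (Eventually.of_forall fun x => (Measure.measurePreserving_sub_left volume (2 * b x)).map_eq)

lemma measurableEmbedding_graphReflection {b : ℝ → ℝ} (hb : Measurable b) :
    MeasurableEmbedding (graphReflection b) :=
  (MeasurableEquiv.ofInvolutive _ (graphReflection_involutive b)
    (measurable_graphReflection hb)).measurableEmbedding

lemma continuous_gaussDensity : Continuous gaussDensity := by
  unfold gaussDensity
  fun_prop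

lemma gaussDensity_pos (z : ℝ × ℝ) : 0 < gaussDensity z := Real.exp_pos _

lemma setIntegral_mGamma (s : Set (ℝ × ℝ)) (f : ℝ × ℝ → ℝ) :
    ∫ z in s, f z ∂mGamma = ∫ z in s, gaussDensity z * f z := by
  rw [mGamma, setIntegral_withDensity_eq_setIntegral_toReal_smul' s
    continuous_gaussDensity.measurable.ennreal_ofReal (by simp)]
  simp [ENNReal.toReal_ofReal (gaussDensity_pos _).le]

/-- Reflecting a point lying above a nonnegative graph does not decrease the Gaussian density. -/
lemma gaussDensity_le_graphReflection {b : ℝ → ℝ} {z : ℝ × ℝ} (h0 : 0 ≤ b z.1) (hz : b z.1 ≤ z.2) :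
    gaussDensity z ≤ gaussDensity (graphReflection b z) := by
  unfold gaussDensity graphReflection
  apply Real.exp_le_exp.2
  simp only
  nlinarith [mul_nonneg h0 (sub_nonneg.2 hz)]

/-- If `f ≤ F ∘ R` almost everywhere on `R⁻¹ D`, where `R` is the reflection across the graph of
`b ≥ 0` and `R⁻¹ D` lies above that graph, then `∫ f` over `R⁻¹ D` is at most `∫ F` over `D`. -/
lemma setIntegral_le_of_le_graphReflection {b : ℝ → ℝ} (hb : Measurable b)
    {D K : Set (ℝ × ℝ)} (hD : MeasurableSet D) (hK : IsCompact K) (hDK : D ⊆ K)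
    (habove : ∀ z, graphReflection b z ∈ D → 0 ≤ b z.1 ∧ b z.1 ≤ z.2)
    {f F : ℝ × ℝ → ℝ} (hF : ContinuousOn F K) (hf : ∀ z, 0 ≤ f z)
    (hfF : ∀ᵐ z ∂(volume.restrict (graphReflection b ⁻¹' D)), f z ≤ F (graphReflection b z)) :
    ∫ z in graphReflection b ⁻¹' D, f z ∂mGamma ≤ ∫ z in D, F z ∂mGamma := by
  have hmp := measurePreserving_graphReflection hb
  have hemb := measurableEmbedding_graphReflection hb
  rw [setIntegral_mGamma, setIntegral_mGamma,
    ← hmp.setIntegral_preimage_emb hemb (fun z => gaussDensity z * F z) D]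
  have hint : IntegrableOn (fun z => gaussDensity z * F z) D :=
    ((continuous_gaussDensity.continuousOn.mul hF).integrableOn_compact hK).mono_set hDK
  refine integral_mono_of_nonneg
    (Eventually.of_forall fun z => mul_nonneg (gaussDensity_pos z).le (hf z))
    ((hmp.integrableOn_comp_preimage hemb).2 hint) ?_
  filter_upwards [hfF, ae_restrict_mem (hmp.measurable hD)] with z hz hzD
  obtain ⟨h0, h1⟩ := habove z hzD
  exact mul_le_mul (gaussDensity_le_graphReflection h0 h1) hz (hf z) (gaussDensity_pos _).le

lemma fderiv_apply_fst_snd (u' : ℝ × ℝ →L[ℝ] ℝ) (s t : ℝ) :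
    u' (s, t) = s * u' (1, 0) + t * u' (0, 1) := by
  have : ((s, t) : ℝ × ℝ) = s • (1, 0) + t • (0, 1) := by simp
  rw [this, map_add, map_smul, map_smul, smul_eq_mul, smul_eq_mul]

/-- If `u` is differentiable at `p 0` with `p` Lipschitz at `0`, then differentiating `u ∘ p` at
`0` amounts to differentiating the linearisation of `u` along `p`. -/
lemma HasDerivAt.linearise_along {u : ℝ × ℝ → ℝ} {u' : ℝ × ℝ →L[ℝ] ℝ} {p : ℝ → ℝ × ℝ} {d : ℝ}
    (hu : HasFDerivAt u u' (p 0)) (hpc : ContinuousAt p 0)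
    (hp : (fun t => p t - p 0) =O[𝓝 0] fun t : ℝ => t)
    (hd : HasDerivAt (fun t => u (p t)) d 0) :
    HasDerivAt (fun t => u' (p t - p 0)) d 0 := by
  have h1 := (hu.isLittleO.comp_tendsto hpc.tendsto).trans_isBigO hp
  have h2 : HasDerivAt (fun t => u (p t) - u' (p t - p 0)) 0 0 := by
    rw [hasDerivAt_iff_isLittleO]
    refine (h1.congr_left fun t => ?_).congr_right fun t => ?_
    · simp; ring
    · simp
  refine (hd.sub h2).congr_deriv (sub_zero d) |>.congr_of_eventuallyEq (Eventually.of_forall fun t => ?_)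
  simp

/-- Pointwise bound for the gradient of a reflected function. -/
lemma gradient_graphReflection_le {L : ℝ} (hL : 0 ≤ L) {b : ℝ → ℝ}
    (hb : LipschitzWith (Real.toNNReal L) b) {u : ℝ × ℝ → ℝ} {u' g : ℝ × ℝ →L[ℝ] ℝ} {z : ℝ × ℝ}
    (hu : HasFDerivAt u u' (graphReflection b z))
    (hg : HasFDerivAt (fun w => u (graphReflection b w)) g z) :
    g (1, 0) ^ 2 + g (0, 1) ^ 2 ≤ (3 + 8 * L ^ 2) * (u' (1, 0) ^ 2 + u' (0, 1) ^ 2) := by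
  have hbL (x y : ℝ) : |b x - b y| ≤ L * |x - y| := by
    simpa [Real.dist_eq, Real.coe_toNNReal _ hL] using hb.dist_le_mul x y
  have hline (v : ℝ × ℝ) : HasDerivAt (fun t : ℝ => u (graphReflection b (z + t • v))) (g v) 0 := by
    have h1 : HasDerivAt (fun t : ℝ => z + t • v) v 0 := by
      simpa using ((hasDerivAt_id (0 : ℝ)).smul_const v).const_add z
    have h2 : HasFDerivAt (fun w => u (graphReflection b w)) g (z + (0 : ℝ) • v) := by simpa using hg
    exact HasFDerivAt.comp_hasDerivAt (l := fun w => u (graphReflection b w)) (0 : ℝ) h2 h1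
  have hvert : g (0, 1) = -u' (0, 1) := by
    have h1 : HasDerivAt (fun t : ℝ => graphReflection b (z + t • ((0, 1) : ℝ × ℝ))) (0, -1) 0 := by
      have h2 : HasDerivAt (fun t : ℝ => 2 * b z.1 - (z.2 + t)) (-1) 0 := by
        simpa using ((hasDerivAt_id (0 : ℝ)).const_add z.2).const_sub (2 * b z.1)
      simpa [graphReflection] using (hasDerivAt_const (0 : ℝ) z.1).prodMk h2
    have h3 : HasFDerivAt u u' (graphReflection b (z + (0 : ℝ) • ((0, 1) : ℝ × ℝ))) := by
      simpa using hu
    have h4 := (h3.comp_hasDerivAt (0 : ℝ) h1).unique (hline (0, 1))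
    rw [← h4, fderiv_apply_fst_snd]
    ring
  have hhor : |g (1, 0)| ≤ |u' (1, 0)| + 2 * L * |u' (0, 1)| := by
    set p : ℝ → ℝ × ℝ := fun t => graphReflection b (z + t • ((1, 0) : ℝ × ℝ)) with hp
    have hp0 : p 0 = graphReflection b z := by simp only [hp, zero_smul, add_zero]
    have hsub (t : ℝ) : p t - p 0 = (t, 2 * (b (z.1 + t) - b z.1)) := by
      simp [hp, graphReflection]; ring
    have hbt (t : ℝ) : |b (z.1 + t) - b z.1| ≤ L * |t| := by simpa using hbL (z.1 + t) z.1
    have hbc := hb.continuous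
    have hpc : Continuous p := by
      simp only [hp, graphReflection]
      fun_prop
    have hO : (fun t => p t - p 0) =O[𝓝 0] fun t : ℝ => t := by
      refine Asymptotics.IsBigO.of_bound (1 + 2 * L) (Eventually.of_forall fun t => ?_)
      rw [hsub, Prod.norm_def, Real.norm_eq_abs, Real.norm_eq_abs, abs_mul, abs_two]
      have := mul_nonneg hL (abs_nonneg t)
      exact max_le (by nlinarith [abs_nonneg t]) (by nlinarith [abs_nonneg t, hbt t])
    have hlin := HasDerivAt.linearise_along (hp0 ▸ hu) hpc.continuousAt hO (hline (1, 0))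
    refine hlin.le_of_lip' (by positivity) (Eventually.of_forall fun t => ?_)
    rw [sub_self (p 0), map_zero, sub_zero, sub_zero, hsub, fderiv_apply_fst_snd,
      Real.norm_eq_abs, Real.norm_eq_abs]
    calc |t * u' (1, 0) + 2 * (b (z.1 + t) - b z.1) * u' (0, 1)|
        ≤ |t| * |u' (1, 0)| + 2 * |b (z.1 + t) - b z.1| * |u' (0, 1)| := by
          refine (abs_add_le _ _).trans_eq ?_
          rw [abs_mul, abs_mul, abs_mul, abs_two]
      _ ≤ |t| * |u' (1, 0)| + 2 * (L * |t|) * |u' (0, 1)| := by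
          gcongr
          exact hbt t
      _ = (|u' (1, 0)| + 2 * L * |u' (0, 1)|) * |t| := by ring
  have hsq : g (1, 0) ^ 2 ≤ (|u' (1, 0)| + 2 * L * |u' (0, 1)|) ^ 2 := by
    rw [← sq_abs]
    gcongr
  rw [hvert, ← sq_abs (u' (1, 0)), ← sq_abs (u' (0, 1)), neg_sq, ← sq_abs (u' (0, 1))]
  nlinarith [sq_nonneg (|u' (1, 0)| - 2 * L * |u' (0, 1)|), sq_nonneg (L * |u' (1, 0)|),
    sq_nonneg (u' (1, 0)), sq_nonneg (u' (0, 1)), sq_abs (u' (0, 1)), sq_abs (u' (1, 0))]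

/-- Reflection estimate across a Lipschitz graph: for every `L > 0` there is `C(L) > 0`
such that, for any square data `(x₀,y₀,r)` and any `L`-Lipschitz `β ≥ 0` with
`|β - y₀| < r/2`, the reflected function `uᵉ(x,y) = u(x, 2β(x) - y)` satisfies
`∫_{Ωᵉ} (uᵉ)² dm_γ ≤ ∫_D u² dm_γ` and `∫_{Ωᵉ} |∇uᵉ|² dm_γ ≤ C(L) ∫_D |∇u|² dm_γ`. -/
theorem reflection_estimate (L : ℝ) (hL : 0 < L) :
    ∃ C : ℝ, 0 < C ∧
      ∀ (r x₀ y₀ : ℝ), 0 < r →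
      ∀ β : ℝ → ℝ, LipschitzOnWith (Real.toNNReal L) β (Set.Icc (x₀ - r) (x₀ + r)) →
        (∀ x ∈ Set.Icc (x₀ - r) (x₀ + r), 0 ≤ β x ∧ |β x - y₀| < r / 2) →
      ∀ u : ℝ × ℝ → ℝ, ∀ V : Set (ℝ × ℝ), IsOpen V → ContDiffOn ℝ 1 u V →
        closure {z : ℝ × ℝ | |z.1 - x₀| < r ∧ 2 * β z.1 - (y₀ + r) < z.2 ∧ z.2 < β z.1} ⊆ V →
        ((∫ z in {z : ℝ × ℝ | |z.1 - x₀| < r ∧ β z.1 < z.2 ∧ z.2 < y₀ + r},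
            (u (z.1, 2 * β z.1 - z.2)) ^ 2 ∂mGamma) ≤
          ∫ z in {z : ℝ × ℝ | |z.1 - x₀| < r ∧ 2 * β z.1 - (y₀ + r) < z.2 ∧ z.2 < β z.1},
            (u z) ^ 2 ∂mGamma) ∧
        (∀ ge : ℝ × ℝ → (ℝ × ℝ) →L[ℝ] ℝ,
          (∀ᵐ z ∂(volume.restrict
              {z : ℝ × ℝ | |z.1 - x₀| < r ∧ β z.1 < z.2 ∧ z.2 < y₀ + r}),
            HasFDerivAt (fun w : ℝ × ℝ => u (w.1, 2 * β w.1 - w.2)) (ge z) z) →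
          (∫ z in {z : ℝ × ℝ | |z.1 - x₀| < r ∧ β z.1 < z.2 ∧ z.2 < y₀ + r},
              ((ge z (1, 0)) ^ 2 + (ge z (0, 1)) ^ 2) ∂mGamma) ≤
            C * ∫ z in {z : ℝ × ℝ | |z.1 - x₀| < r ∧ 2 * β z.1 - (y₀ + r) < z.2 ∧ z.2 < β z.1},
              ((fderiv ℝ u z (1, 0)) ^ 2 + (fderiv ℝ u z (0, 1)) ^ 2) ∂mGamma) := by
  refine ⟨3 + 8 * L ^ 2, by positivity, ?_⟩
  intro r x₀ y₀ hr β hβ hβr u V hV hu hDV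
  obtain ⟨b, hb, hβb⟩ := hβ.extend_real
  have hbm := hb.continuous.measurable
  have hstrip {x : ℝ} (hx : |x - x₀| < r) : x ∈ Set.Icc (x₀ - r) (x₀ + r) := by
    rw [abs_lt] at hx
    constructor <;> linarith
  set D : Set (ℝ × ℝ) :=
    {z | |z.1 - x₀| < r ∧ 2 * β z.1 - (y₀ + r) < z.2 ∧ z.2 < β z.1}
  have hDb : D = {z | |z.1 - x₀| < r ∧ 2 * b z.1 - (y₀ + r) < z.2 ∧ z.2 < b z.1} := by
    ext z
    refine and_congr_right fun hz => ?_
    rw [hβb (hstrip hz)]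
  have hΩ : {z : ℝ × ℝ | |z.1 - x₀| < r ∧ β z.1 < z.2 ∧ z.2 < y₀ + r} =
      graphReflection b ⁻¹' D := by
    rw [hDb]
    ext z
    refine and_congr_right fun hz => ?_
    rw [hβb (hstrip hz)]
    simp only [graphReflection]
    constructor <;> rintro ⟨h1, h2⟩ <;> constructor <;> linarith
  have hDm : MeasurableSet D := by
    have hbc := hb.continuous
    rw [hDb]
    have h1 : Continuous fun z : ℝ × ℝ => |z.1 - x₀| := by fun_prop
    have h2 : Continuous fun z : ℝ × ℝ => 2 * b z.1 - (y₀ + r) := by fun_prop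
    have h3 : Continuous fun z : ℝ × ℝ => b z.1 := by fun_prop
    exact ((isOpen_lt h1 continuous_const).inter
      ((isOpen_lt h2 continuous_snd).inter (isOpen_lt continuous_snd h3))).measurableSet
  have hK : IsCompact (closure D) := by
    refine (((isCompact_Icc (a := x₀ - r) (b := x₀ + r)).prod
      (isCompact_Icc (a := y₀ - 2 * r) (b := y₀ + r))).isBounded.subset ?_).isCompact_closure
    rintro z ⟨h1, h2, h3⟩
    have h4 := abs_lt.1 (hβr z.1 (hstrip h1)).2
    exact ⟨hstrip h1, by linarith, by linarith⟩
  have habove (z : ℝ × ℝ) (hz : graphReflection b z ∈ D) : 0 ≤ b z.1 ∧ b z.1 ≤ z.2 := by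
    rw [← Set.mem_preimage, ← hΩ] at hz
    rw [← hβb (hstrip hz.1)]
    exact ⟨(hβr z.1 (hstrip hz.1)).1, hz.2.1.le⟩
  have hcont := hu.continuousOn.mono hDV
  have hfc := (hu.continuousOn_fderiv_of_isOpen hV le_rfl).mono hDV
  rw [hΩ]
  refine ⟨setIntegral_le_of_le_graphReflection hbm hDm hK subset_closure habove (hcont.pow 2)
    (fun z => sq_nonneg _) ?_, fun ge hge => ?_⟩
  · filter_upwards [ae_restrict_mem (measurable_graphReflection hbm hDm)] with z hz
    rw [← hΩ] at hz
    rw [hβb (hstrip hz.1)]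
    rfl
  · rw [← integral_const_mul]
    refine setIntegral_le_of_le_graphReflection hbm hDm hK subset_closure habove
      (F := fun z => (3 + 8 * L ^ 2) *
        ((fderiv ℝ u z (1, 0)) ^ 2 + (fderiv ℝ u z (0, 1)) ^ 2)) (by fun_prop)
      (fun z => by positivity) ?_
    filter_upwards [hge, ae_restrict_mem (measurable_graphReflection hbm hDm)] with z hz hzD
    have hzV : graphReflection b z ∈ V := hDV (subset_closure hzD)
    have hud := (hu.differentiableOn one_ne_zero).differentiableAt (hV.mem_nhds hzV)
    refine gradient_graphReflection_le hL.le hb hud.hasFDerivAt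
      (hz.congr_of_eventuallyEq ?_)
    have hopen : IsOpen {w : ℝ × ℝ | |w.1 - x₀| < r} := isOpen_lt (by fun_prop) (by fun_prop)
    filter_upwards [hopen.mem_nhds (show z ∈ _ from hzD.1)] with w hw
    rw [hβb (hstrip hw)]
    rfl
end

section
/- Let Ω ⊆ ℝ² be a nonempty open convex set and let u ∈ L¹(Ω, m_γ) satisfy ∫_Ω u dm_γ = 0. Then there exist a unit vector ω ∈ ℝ² and c ∈ ℝ such that, with the open half-planes H⁻ = {z ∈ ℝ² : z·ω < c} and H⁺ = {z ∈ ℝ² : z·ω > c}, one has m_γ(Ω ∩ H⁻) = m_γ(Ω ∩ H⁺) = m_γ(Ω)/2 and ∫_{Ω ∩ H⁻} u dm_γ = ∫_{Ω ∩ H⁺} u dm_γ = 0. -/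
open MeasureTheory Real Set Filter Topology

/-- The inner product of `z` with the unit vector of angle `θ`. -/
noncomputable def angleForm (θ : ℝ) (z : ℝ × ℝ) : ℝ := z.1 * cos θ + z.2 * sin θ

lemma continuous_angleForm (θ : ℝ) : Continuous (angleForm θ) := by
  unfold angleForm; fun_prop

lemma angleForm_add_pi (θ : ℝ) (z : ℝ × ℝ) : angleForm (θ + π) z = -angleForm θ z := by
  simp only [angleForm, cos_add_pi, sin_add_pi]; ring

lemma volume_angleForm_eq (θ c : ℝ) : volume {z : ℝ × ℝ | angleForm θ z = c} = 0 := by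
  let s : AffineSubspace ℝ (ℝ × ℝ) :=
    { carrier := {z | angleForm θ z = c}
      smul_vsub_vadd_mem' := by
        intro r p q w hp hq hw
        simp only [angleForm, mem_ofPred_eq, vsub_eq_sub, vadd_eq_add, Prod.fst_add, Prod.snd_add,
          Prod.smul_fst, Prod.smul_snd, Prod.fst_sub, Prod.snd_sub, smul_eq_mul] at *
        linear_combination r * hp - r * hq + hw }
  refine Measure.addHaar_affineSubspace volume s fun hs => ?_
  have key : ∀ z : ℝ × ℝ, angleForm θ z = c := fun z => by
    have : z ∈ s := by rw [hs]; exact AffineSubspace.mem_top ℝ _ z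
    exact this
  have h0 := key (0, 0)
  have h1 := key (cos θ, sin θ)
  simp only [angleForm] at h0 h1
  nlinarith [cos_sq_add_sin_sq θ]

lemma mGamma_absolutelyContinuous : mGamma ≪ volume := withDensity_absolutelyContinuous _ _

/-- Gaussian measure on `Ω` is absolutely continuous with respect to area. -/
lemma restrict_mGamma_absolutelyContinuous (Ω : Set (ℝ × ℝ)) : mGamma.restrict Ω ≪ volume :=
  Measure.restrict_le_self.absolutelyContinuous.trans mGamma_absolutelyContinuous

lemma measurable_gaussDensity : Measurable gaussDensity := by
  unfold gaussDensity; fun_prop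

lemma volume_absolutelyContinuous_mGamma : volume ≪ mGamma := by
  refine withDensity_absolutelyContinuous' measurable_gaussDensity.ennreal_ofReal.aemeasurable ?_
  refine ae_of_all _ fun z => ?_
  simp [gaussDensity, exp_pos]

instance isFiniteMeasure_mGamma : IsFiniteMeasure mGamma := by
  refine isFiniteMeasure_withDensity_ofReal (Integrable.hasFiniteIntegral (f := gaussDensity) ?_)
  have h := integrable_exp_neg_mul_sq (b := 1 / 2) (by norm_num)
  refine (h.mul_prod h).congr (ae_of_all _ fun z => ?_)
  simp only [gaussDensity, ← exp_add]
  congr 1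
  ring

/-- The integral of `f` over the open half-plane `{z | angleForm θ z < t}`. -/
noncomputable def halfIntegral (ν : Measure (ℝ × ℝ)) (f : ℝ × ℝ → ℝ) (θ t : ℝ) : ℝ :=
  ∫ z in {z | angleForm θ z < t}, f z ∂ν

lemma measurableSet_angleForm_lt (θ t : ℝ) : MeasurableSet {z | angleForm θ z < t} :=
  (isOpen_lt (continuous_angleForm θ) continuous_const).measurableSet

lemma measurableSet_lt_angleForm (θ t : ℝ) : MeasurableSet {z | t < angleForm θ z} :=
  (isOpen_lt continuous_const (continuous_angleForm θ)).measurableSet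

section HalfIntegral

variable {ν : Measure (ℝ × ℝ)} {f : ℝ × ℝ → ℝ}

lemma tendsto_halfIntegral {ι : Type*} {l : Filter ι} [l.IsCountablyGenerated]
    (hf : Integrable f ν) {a b : ι → ℝ} {S : Set (ℝ × ℝ)} (hS : MeasurableSet S)
    (h : ∀ᵐ z ∂ν, ∀ᶠ i in l, (angleForm (a i) z < b i ↔ z ∈ S)) :
    Tendsto (fun i => halfIntegral ν f (a i) (b i)) l (𝓝 (∫ z in S, f z ∂ν)) := by
  simp only [halfIntegral, ← integral_indicator (measurableSet_angleForm_lt _ _),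
    ← integral_indicator hS]
  refine tendsto_integral_filter_of_dominated_convergence (fun z => ‖f z‖)
    (Eventually.of_forall fun i =>
      hf.aestronglyMeasurable.indicator (measurableSet_angleForm_lt _ _))
    (Eventually.of_forall fun i => ae_of_all _ fun z => norm_indicator_le_norm_self _ _)
    hf.norm ?_
  filter_upwards [h] with z hz
  refine tendsto_const_nhds.congr' ?_
  filter_upwards [hz] with i hi
  by_cases hzS : z ∈ S
  · rw [indicator_of_mem hzS, indicator_of_mem (s := {z | angleForm (a i) z < b i}) (hi.2 hzS)]
  · rw [indicator_of_notMem hzS, indicator_of_notMem (s := {z | angleForm (a i) z < b i}) fun h => hzS (hi.1 h)]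

lemma ae_angleForm_ne (hν : ν ≪ volume) (θ t : ℝ) : ∀ᵐ z ∂ν, angleForm θ z ≠ t := by
  have h : ∀ᵐ z ∂(volume : Measure (ℝ × ℝ)), angleForm θ z ≠ t := by
    rw [ae_iff]; simpa using volume_angleForm_eq θ t
  exact hν.ae_le h

lemma continuous_halfIntegral {X : Type*} [TopologicalSpace X] [FirstCountableTopology X]
    (hν : ν ≪ volume) (hf : Integrable f ν) {a b : X → ℝ} (ha : Continuous a)
    (hb : Continuous b) : Continuous fun x => halfIntegral ν f (a x) (b x) := by
  refine continuous_iff_continuousAt.2 fun x => ?_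
  refine tendsto_halfIntegral hf (measurableSet_angleForm_lt (a x) (b x)) ?_
  filter_upwards [ae_angleForm_ne hν (a x) (b x)] with z hz
  have hc : Continuous fun y => angleForm (a y) z := by unfold angleForm; fun_prop
  rcases lt_or_gt_of_ne hz with h | h
  · filter_upwards [hc.continuousAt.eventually_lt hb.continuousAt h] with y hy
    exact iff_of_true hy h
  · filter_upwards [hb.continuousAt.eventually_lt hc.continuousAt h] with y hy
    exact iff_of_false hy.not_gt h.not_gt

lemma tendsto_halfIntegral_atTop (hf : Integrable f ν) (θ : ℝ) :
    Tendsto (halfIntegral ν f θ) atTop (𝓝 (∫ z, f z ∂ν)) := by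
  rw [← setIntegral_univ]
  refine tendsto_halfIntegral (a := fun _ => θ) (b := id) hf .univ (ae_of_all _ fun z => ?_)
  filter_upwards [eventually_gt_atTop (angleForm θ z)] with t ht
  exact iff_of_true ht (mem_univ z)

lemma tendsto_halfIntegral_atBot (hf : Integrable f ν) (θ : ℝ) :
    Tendsto (halfIntegral ν f θ) atBot (𝓝 0) := by
  have h := tendsto_halfIntegral (ν := ν) (l := atBot) (a := fun _ => θ) (b := id) hf .empty
    (ae_of_all _ fun z => by
      filter_upwards [eventually_lt_atBot (angleForm θ z)] with t ht
      exact iff_of_false (not_lt.2 (le_of_lt ht)) (notMem_empty z))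
  simpa using h

lemma setIntegral_lt_angleForm (hν : ν ≪ volume) (hf : Integrable f ν) (θ t : ℝ) :
    ∫ z in {z | t < angleForm θ z}, f z ∂ν = ∫ z, f z ∂ν - halfIntegral ν f θ t := by
  rw [halfIntegral, ← integral_add_compl (measurableSet_angleForm_lt θ t) hf, add_sub_cancel_left]
  refine setIntegral_congr_set ?_
  filter_upwards [ae_angleForm_ne hν θ t] with z hz
  exact propext ⟨fun h => not_lt.2 (le_of_lt h), fun h => lt_of_le_of_ne (not_lt.1 h) hz.symm⟩

lemma halfIntegral_add_pi (hν : ν ≪ volume) (hf : Integrable f ν) (θ t : ℝ) :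
    halfIntegral ν f (θ + π) (-t) = ∫ z, f z ∂ν - halfIntegral ν f θ t := by
  rw [← setIntegral_lt_angleForm hν hf, halfIntegral]
  simp only [angleForm_add_pi, neg_lt_neg_iff]

lemma halfIntegral_one (θ t : ℝ) :
    halfIntegral ν (fun _ => 1) θ t = ν.real {z | angleForm θ z < t} := by
  simp [halfIntegral]

end HalfIntegral

section Median

variable {Ω : Set (ℝ × ℝ)}

lemma exists_mem_of_measureReal_pos {ν : Measure (ℝ × ℝ)} {S : Set (ℝ × ℝ)}
    (h : 0 < (ν.restrict Ω).real S) (hS : MeasurableSet S) : ∃ z ∈ Ω, z ∈ S := by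
  by_contra! hc
  have : S ∩ Ω = ∅ := by
    ext z; simp only [mem_inter_iff, mem_empty_iff_false, iff_false, not_and]
    exact fun h1 h2 => hc z h2 h1
  simp [measureReal_restrict_apply hS, this] at h

/-- Between two levels, neither of which is extreme, the mass of a half-plane increases strictly. -/
lemma halfIntegral_one_lt (hop : IsOpen Ω) (hconv : Convex ℝ Ω) (θ : ℝ) {s t : ℝ} (hst : s < t)
    (ht : 0 < halfIntegral (mGamma.restrict Ω) (fun _ => 1) θ t)
    (hs : halfIntegral (mGamma.restrict Ω) (fun _ => 1) θ s < (mGamma.restrict Ω).real univ) :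
    halfIntegral (mGamma.restrict Ω) (fun _ => 1) θ s <
      halfIntegral (mGamma.restrict Ω) (fun _ => 1) θ t := by
  simp only [halfIntegral_one] at *
  obtain ⟨p, hpΩ, hp⟩ := exists_mem_of_measureReal_pos ht (measurableSet_angleForm_lt θ t)
  have hs' : 0 < (mGamma.restrict Ω).real {z | angleForm θ z < s}ᶜ := by
    rw [measureReal_compl (measurableSet_angleForm_lt θ s)]; linarith
  have hs'' : 0 < (mGamma.restrict Ω).real {z | s < angleForm θ z} := by
    refine hs'.trans_eq (measureReal_congr ?_)
    filter_upwards [ae_angleForm_ne (restrict_mGamma_absolutelyContinuous Ω) θ s] with z hz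
    exact propext ⟨fun h => lt_of_le_of_ne (not_lt.1 h) hz.symm, fun h => not_lt.2 (le_of_lt h)⟩
  obtain ⟨q, hqΩ, hq⟩ := exists_mem_of_measureReal_pos hs'' (measurableSet_lt_angleForm θ s)
  simp only [mem_ofPred_eq] at hp hq
  have hconn : (angleForm θ '' Ω).OrdConnected :=
    (hconv.isPreconnected.image _ (continuous_angleForm θ).continuousOn).ordConnected
  have hU : (Ω ∩ {z | s < angleForm θ z ∧ angleForm θ z < t}).Nonempty := by
    by_cases h1 : s < angleForm θ p
    · exact ⟨p, hpΩ, h1, hp⟩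
    by_cases h2 : angleForm θ q < t
    · exact ⟨q, hqΩ, hq, h2⟩
    obtain ⟨z, hz, hzv⟩ := hconn.out (mem_image_of_mem _ hpΩ) (mem_image_of_mem _ hqΩ)
      (show (s + t) / 2 ∈ _ from ⟨by linarith, by linarith⟩)
    exact ⟨z, hz, by constructor <;> linarith⟩
  have hUo : IsOpen {z | s < angleForm θ z ∧ angleForm θ z < t} :=
    (isOpen_lt continuous_const (continuous_angleForm θ)).inter
      (isOpen_lt (continuous_angleForm θ) continuous_const)
  have hpos : 0 < (mGamma.restrict Ω).real {z | s < angleForm θ z ∧ angleForm θ z < t} := by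
    rw [measureReal_restrict_apply hUo.measurableSet, inter_comm, measureReal_def]
    refine ENNReal.toReal_pos (fun h => ?_) (measure_ne_top _ _)
    exact (hop.inter hUo).measure_ne_zero volume hU (volume_absolutelyContinuous_mGamma h)
  have hdisj : Disjoint {z | angleForm θ z < s} {z | s < angleForm θ z ∧ angleForm θ z < t} :=
    disjoint_left.2 fun z (h1 : _ < _) h2 => h1.not_gt h2.1
  have hle : (mGamma.restrict Ω).real
      ({z | angleForm θ z < s} ∪ {z | s < angleForm θ z ∧ angleForm θ z < t}) ≤
      (mGamma.restrict Ω).real {z | angleForm θ z < t} :=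
    measureReal_mono (union_subset (fun z (h : _ < _) => h.trans hst) fun z h => h.2)
  rw [measureReal_union hdisj hUo.measurableSet] at hle
  linarith

lemma measureReal_restrict_mGamma_pos (hne : Ω.Nonempty) (hop : IsOpen Ω) :
    0 < (mGamma.restrict Ω).real univ := by
  rw [measureReal_restrict_apply .univ, univ_inter, measureReal_def]
  exact ENNReal.toReal_pos (fun h => hop.measure_ne_zero volume hne
    (volume_absolutelyContinuous_mGamma h)) (measure_ne_top _ _)

/-- The halving level exists, and depends continuously and oddly on the direction. -/
lemma exists_continuous_median {ν : Measure (ℝ × ℝ)} [IsFiniteMeasure ν] (hν : ν ≪ volume)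
    (hm : 0 < ν.real univ)
    (hlt : ∀ θ {s t : ℝ}, s < t → 0 < halfIntegral ν (fun _ => 1) θ t →
      halfIntegral ν (fun _ => 1) θ s < ν.real univ →
      halfIntegral ν (fun _ => 1) θ s < halfIntegral ν (fun _ => 1) θ t) :
    ∃ c : ℝ → ℝ, Continuous c ∧ (∀ θ, c (θ + π) = -c θ) ∧
      ∀ θ, halfIntegral ν (fun _ => 1) θ (c θ) = ν.real univ / 2 := by
  have h1 : Integrable (fun _ : ℝ × ℝ => (1 : ℝ)) ν := integrable_const 1
  have hint : ∫ _, (1 : ℝ) ∂ν = ν.real univ := by simp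
  have hex : ∀ θ, ∃ c, halfIntegral ν (fun _ => 1) θ c = ν.real univ / 2 := fun θ => by
    have htop := tendsto_halfIntegral_atTop h1 θ
    rw [hint] at htop
    obtain ⟨a, ha⟩ := ((tendsto_halfIntegral_atBot h1 θ).eventually_lt_const (half_pos hm)).exists
    obtain ⟨b, hb⟩ := (htop.eventually_const_lt (half_lt_self hm)).exists
    have hθ : Continuous (halfIntegral ν (fun _ => 1) θ) := 
      continuous_halfIntegral hν h1 continuous_const continuous_id
    exact mem_range.1 (intermediate_value_univ a b hθ (mem_Icc.2 ⟨ha.le, hb.le⟩))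
  choose c hc using hex
  have above : ∀ θ t, c θ < t ↔ ν.real univ / 2 < halfIntegral ν (fun _ => 1) θ t := by
    intro θ t
    rw [← hc θ]
    constructor
    · intro h
      have hmono : halfIntegral ν (fun _ => 1) θ (c θ) ≤ halfIntegral ν (fun _ => 1) θ t := by
        rw [halfIntegral_one, halfIntegral_one]
        exact measureReal_mono fun z (hz : _ < _) => hz.trans h
      exact hlt θ h ((by rw [hc]; exact half_pos hm : (0 : ℝ) < _).trans_le hmono)
        (by rw [hc]; exact half_lt_self hm)
    · intro h
      by_contra! hle
      refine h.not_ge ?_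
      rw [halfIntegral_one, halfIntegral_one]
      exact measureReal_mono fun z (hz : _ < _) => hz.trans_le hle
  have below : ∀ θ t, t < c θ ↔ halfIntegral ν (fun _ => 1) θ t < ν.real univ / 2 := by
    intro θ t
    constructor
    · intro h
      by_contra! hle
      have := hlt θ h (by rw [hc]; exact half_pos hm)
        (lt_of_not_ge fun hge => by
          have : halfIntegral ν (fun _ => 1) θ t ≤ halfIntegral ν (fun _ => 1) θ (c θ) := by
            rw [halfIntegral_one, halfIntegral_one]
            exact measureReal_mono fun z (hz : _ < _) => hz.trans h
          rw [hc] at this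
          linarith)
      rw [hc] at this
      linarith
    · intro h
      by_contra! hle
      rcases hle.eq_or_lt with rfl | h'
      · exact h.ne (hc θ)
      · exact h.not_gt ((above θ t).1 h')
  refine ⟨c, continuous_iff_continuousAt.2 fun θ => ?_, fun θ => ?_, hc⟩
  · refine tendsto_order.2 ⟨fun t ht => ?_, fun t ht => ?_⟩
    · simp only [below] at ht ⊢
      exact (continuous_halfIntegral hν h1 continuous_id continuous_const).continuousAt.eventually_lt_const ht
    · simp only [above] at ht ⊢
      exact (continuous_halfIntegral hν h1 continuous_id continuous_const).continuousAt.eventually_const_lt ht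
  · have hval := halfIntegral_add_pi hν h1 θ (c θ)
    rw [hint, hc] at hval
    refine le_antisymm (not_lt.1 fun h => ?_) (not_lt.1 fun h => ?_)
    · rw [below] at h; linarith
    · rw [above] at h; linarith

/-- Along a continuous odd family of half-planes, a zero-mean function has zero integral on one. -/
lemma exists_halfIntegral_eq_zero {ν : Measure (ℝ × ℝ)}
    (hν : ν ≪ volume) {u : ℝ × ℝ → ℝ} (hint : Integrable u ν) (hmean : ∫ z, u z ∂ν = 0)
    {c : ℝ → ℝ} (hcc : Continuous c) (hcπ : ∀ θ, c (θ + π) = -c θ) :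
    ∃ θ, halfIntegral ν u θ (c θ) = 0 := by
  have hF : Continuous fun θ => halfIntegral ν u θ (c θ) :=
    continuous_halfIntegral hν hint continuous_id hcc
  have hFπ : halfIntegral ν u (0 + π) (c (0 + π)) = -halfIntegral ν u 0 (c 0) := by
    rw [hcπ, halfIntegral_add_pi hν hint, hmean, zero_sub]
  rcases le_total (halfIntegral ν u 0 (c 0)) 0 with h | h
  · exact mem_range.1 (intermediate_value_univ 0 (0 + π) hF (mem_Icc.2 ⟨h, by linarith⟩))
  · exact mem_range.1 (intermediate_value_univ (0 + π) 0 hF (mem_Icc.2 ⟨by linarith, h⟩))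

end Median

/-- Simultaneous bisection: for a nonempty open convex `Ω ⊆ ℝ²` and
`u ∈ L¹(Ω, m_γ)` with zero mean, there is a line (direction `ω`, offset `c`)
halving the Gaussian area of `Ω` so that `u` has zero mean on each open half. -/
theorem bisection_zero_mean (Ω : Set (ℝ × ℝ)) (hne : Ω.Nonempty) (hop : IsOpen Ω)
    (hconv : Convex ℝ Ω) (u : ℝ × ℝ → ℝ)
    (hint : Integrable u (mGamma.restrict Ω))
    (hmean : (∫ z in Ω, u z ∂mGamma) = 0) :
    ∃ ω : ℝ × ℝ, ω.1 ^ 2 + ω.2 ^ 2 = 1 ∧ ∃ c : ℝ,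
      mGamma (Ω ∩ {z : ℝ × ℝ | z.1 * ω.1 + z.2 * ω.2 < c}) = mGamma Ω / 2 ∧
      mGamma (Ω ∩ {z : ℝ × ℝ | c < z.1 * ω.1 + z.2 * ω.2}) = mGamma Ω / 2 ∧
      (∫ z in Ω ∩ {z : ℝ × ℝ | z.1 * ω.1 + z.2 * ω.2 < c}, u z ∂mGamma) = 0 ∧
      (∫ z in Ω ∩ {z : ℝ × ℝ | c < z.1 * ω.1 + z.2 * ω.2}, u z ∂mGamma) = 0 := by
  have hν := restrict_mGamma_absolutelyContinuous Ω
  obtain ⟨c, hcc, hcπ, hc⟩ := exists_continuous_median hν (measureReal_restrict_mGamma_pos hne hop)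
    fun θ {_ _} hst => halfIntegral_one_lt hop hconv θ hst
  obtain ⟨θ, hθ⟩ := exists_halfIntegral_eq_zero hν hint hmean hcc hcπ
  have hlo := measurableSet_angleForm_lt θ (c θ)
  have hhi := measurableSet_lt_angleForm θ (c θ)
  have half : ∀ S, MeasurableSet S → (mGamma.restrict Ω).real S = (mGamma.restrict Ω).real univ / 2 →
      mGamma (Ω ∩ S) = mGamma Ω / 2 := fun S hS h => by
    rw [inter_comm, ← Measure.restrict_apply hS, ← Measure.restrict_apply_univ Ω,
      ← ENNReal.toReal_eq_toReal_iff' (measure_ne_top _ _)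
        (ENNReal.div_ne_top (measure_ne_top _ _) two_ne_zero), ENNReal.toReal_div]
    exact h
  refine ⟨(cos θ, sin θ), cos_sq_add_sin_sq θ, c θ, ?_⟩
  change mGamma (Ω ∩ {z | angleForm θ z < c θ}) = _ ∧ mGamma (Ω ∩ {z | c θ < angleForm θ z}) = _ ∧
    ∫ z in Ω ∩ {z | angleForm θ z < c θ}, u z ∂mGamma = 0 ∧
    ∫ z in Ω ∩ {z | c θ < angleForm θ z}, u z ∂mGamma = 0
  refine ⟨half _ hlo ?_, half _ hhi ?_, ?_, ?_⟩
  · rw [← hc θ, halfIntegral_one]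
  · have h := setIntegral_lt_angleForm hν (integrable_const (1 : ℝ)) θ (c θ)
    rw [hc, setIntegral_const, integral_const, smul_eq_mul, smul_eq_mul, mul_one, mul_one] at h
    linarith
  · rw [inter_comm, ← Measure.restrict_restrict hlo]
    exact hθ
  · rw [inter_comm, ← Measure.restrict_restrict hhi, setIntegral_lt_angleForm hν hint, hmean, hθ,
      sub_zero]
end
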